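/- arXiv:1902.05932 — 3 statements merged into one kernel-verified Lean document; each statement's English description precedes it below -/
import Mathlib

section
/- Let μ be a finite positive Borel measure on the open unit disk 𝔻, and let φ : (0, 2π] → (0, ∞) be an increasing function such that ∫₀^{2π} φ(x)/x dx < ∞. If μ satisfies the one-box condition μ(S(I)) = O(φ(|I|)) as |I| → 0 (that is, there exist constants C > 0 and ε > 0 such that μ(S(I)) ≤ C·φ(|I|) for every arc I of the unit circle with |I| < ε), then μ is a Carleson measure for the Dirichlet space 𝒟. -/
open MeasureTheory Metric Complex Filter Set

noncomputable section

/-- Membership in the Dirichlet space: `f` is holomorphic on the unit disk and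
its Dirichlet integral is finite. -/
def InDirichlet (f : ℂ → ℂ) : Prop :=
  DifferentiableOn ℂ f (Metric.ball (0:ℂ) 1) ∧
    IntegrableOn (fun z => ‖deriv f z‖ ^ 2) (Metric.ball (0:ℂ) 1) volume

/-- The square of the Dirichlet norm: `‖f‖_𝒟² = |f(0)|² + (1/π)∫_𝔻 |f′|² dA`. -/
def dirichletNormSq (f : ℂ → ℂ) : ℝ :=
  ‖f 0‖ ^ 2 + (1 / Real.pi) * ∫ z in Metric.ball (0:ℂ) 1, ‖deriv f z‖ ^ 2

/-- `μ` is a Carleson measure for the Dirichlet space. -/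
def IsCarlesonDirichlet (μ : Measure ℂ) : Prop :=
  ∃ C : ℝ, ∀ f : ℂ → ℂ, InDirichlet f →
    ∫⁻ z in Metric.ball (0:ℂ) 1, ENNReal.ofReal (‖f z‖ ^ 2) ∂μ ≤
      ENNReal.ofReal (C * dirichletNormSq f)

/-- The Carleson box `S(I)` over the arc `I = {e^{iα} : θ ≤ α ≤ θ + ℓ}` of arclength `ℓ`. -/
def carlesonBox (θ ℓ : ℝ) : Set ℂ :=
  {z : ℂ | ∃ r α : ℝ, 1 - ℓ < r ∧ r < 1 ∧ θ ≤ α ∧ α ≤ θ + ℓ ∧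
    z = r * Complex.exp (α * Complex.I)}

/-- The angular distance to `0` is controlled by the distance of `s e^{iγ}` to `1`. -/
lemma abs_angle_le_pi_mul_norm_one_sub {s γ : ℝ} (hs : 0 ≤ s) (hγ : |γ| ≤ Real.pi) :
    |γ| ≤ Real.pi * ‖1 - (s : ℂ) * Complex.exp (γ * Complex.I)‖ := by
  have hpi := Real.pi_pos
  have hre : (1 - (s : ℂ) * Complex.exp (γ * Complex.I)).re = 1 - s * Real.cos γ := by
    simp [Complex.exp_ofReal_mul_I_re]
  have him : (1 - (s : ℂ) * Complex.exp (γ * Complex.I)).im = - (s * Real.sin γ) := by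
    simp [Complex.exp_ofReal_mul_I_im]
  rcases le_or_gt |γ| (Real.pi / 2) with h | h
  · have h1 : |Real.sin γ| ≤ ‖1 - (s : ℂ) * Complex.exp (γ * Complex.I)‖ := by
      rw [Complex.norm_def]
      apply Real.abs_le_sqrt
      rw [Complex.normSq_apply, hre, him]
      nlinarith [sq_nonneg (s - Real.cos γ), Real.sin_sq_add_cos_sq γ]
    have h2 := Real.mul_abs_le_abs_sin h
    have h3 : |γ| = Real.pi / 2 * (2 / Real.pi * |γ|) := by field_simp
    rw [h3]
    have := norm_nonneg (1 - (s : ℂ) * Complex.exp (γ * Complex.I))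
    nlinarith
  · have hcos : Real.cos γ ≤ 0 := by
      rw [← Real.cos_abs]
      exact Real.cos_nonpos_of_pi_div_two_le_of_le h.le (by linarith)
    have h1 := Complex.re_le_norm (1 - (s : ℂ) * Complex.exp (γ * Complex.I))
    rw [hre] at h1
    have : 1 ≤ ‖1 - (s : ℂ) * Complex.exp (γ * Complex.I)‖ := by nlinarith
    nlinarith

/-- Points of the disk close to `1 / w̄` lie in a Carleson box of comparable size. -/
lemma exists_carlesonBox_superset (w : ℂ) (hw : ‖w‖ < 1) :
    ∃ β : ℝ, ∀ s : ℝ, {z : ℂ | ‖z‖ < 1 ∧ 2 * Real.pi * ‖1 - z * starRingEnd ℂ w‖ < s} ⊆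
      carlesonBox (β - s / 2) s := by
  refine ⟨w.arg, fun s z ⟨hz, hzs⟩ => ?_⟩
  have hpi := Real.pi_gt_three
  have hrot : z * starRingEnd ℂ w =
      ((‖z‖ * ‖w‖ : ℝ) : ℂ) * Complex.exp ((z * starRingEnd ℂ w).arg * Complex.I) := by
    have := Complex.norm_mul_exp_arg_mul_I (z * starRingEnd ℂ w)
    rw [norm_mul, RCLike.norm_conj] at this
    exact this.symm
  set γ := (z * starRingEnd ℂ w).arg with hγ
  have hangle : |γ| ≤ Real.pi * ‖1 - z * starRingEnd ℂ w‖ := by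
    have := abs_angle_le_pi_mul_norm_one_sub (s := ‖z‖ * ‖w‖) (γ := γ) (by positivity)
      (Complex.abs_arg_le_pi _)
    rwa [← hrot] at this
  have hdist : 1 - ‖z‖ ≤ ‖1 - z * starRingEnd ℂ w‖ := by
    have h1 := norm_sub_norm_le 1 (z * starRingEnd ℂ w)
    simp only [norm_one, norm_mul, RCLike.norm_conj] at h1
    nlinarith [norm_nonneg z, norm_nonneg w]
  have habs : |γ| < s / 2 := by nlinarith
  have hsub : 1 - s < ‖z‖ := by
    nlinarith [norm_nonneg (1 - z * starRingEnd ℂ w)]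
  by_cases h0 : w = 0
  · subst h0
    have hs : 2 * Real.pi < s := by simpa using hzs
    have := abs_le.1 (Complex.abs_arg_le_pi z)
    refine ⟨‖z‖, z.arg, hsub, hz, ?_, ?_, (Complex.norm_mul_exp_arg_mul_I z).symm⟩ <;>
      simp only [Complex.arg_zero] <;> linarith
  · have := abs_lt.1 habs
    refine ⟨‖z‖, w.arg + γ, hsub, hz, by linarith, by linarith, ?_⟩
    have hw0 : (‖w‖ : ℂ) ≠ 0 := by simpa using h0
    have hcw : starRingEnd ℂ w ≠ 0 := by simpa using h0
    have key : z * starRingEnd ℂ w = ‖z‖ * ‖w‖ * Complex.exp (γ * Complex.I) := by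
      simpa using hrot
    have hww : w * starRingEnd ℂ w = (‖w‖ : ℂ) ^ 2 := Complex.mul_conj' w
    have hwp := Complex.norm_mul_exp_arg_mul_I w
    apply mul_right_cancel₀ hcw
    rw [key]
    push_cast
    rw [add_mul, Complex.exp_add]
    apply mul_left_cancel₀ hw0
    calc (‖w‖ : ℂ) * (‖z‖ * ‖w‖ * Complex.exp (γ * Complex.I))
        = ‖z‖ * Complex.exp (γ * Complex.I) * (‖w‖ : ℂ) ^ 2 := by ring
      _ = ‖z‖ * Complex.exp (γ * Complex.I) *
          ((‖w‖ * Complex.exp (w.arg * Complex.I)) * starRingEnd ℂ w) := by rw [hwp, hww]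
      _ = _ := by ring

/-- Layer-cake formula for the positive part of `log (ε / y)`. -/
lemma ofReal_log_div_eq_lintegral {ε y : ℝ} (hε : 0 < ε) (hy : 0 < y) :
    ENNReal.ofReal (Real.log (ε / y)) =
      ∫⁻ s in Ioo 0 ε, (Ioi y).indicator (fun s => ENNReal.ofReal s⁻¹) s := by
  rw [setLIntegral_indicator measurableSet_Ioi]
  have hset : Ioi y ∩ Ioo 0 ε = Ioo y ε := by
    ext s; simp only [mem_inter_iff, mem_Ioi, mem_Ioo]
    constructor
    · rintro ⟨h1, _, h3⟩; exact ⟨h1, h3⟩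
    · rintro ⟨h1, h3⟩; exact ⟨h1, hy.trans h1, h3⟩
  rw [hset]
  rcases le_or_gt ε y with h | h
  · rw [Ioo_eq_empty (not_lt.2 h)]
    simp only [Measure.restrict_empty, lintegral_zero_measure, ENNReal.ofReal_eq_zero]
    exact Real.log_nonpos (by positivity) (by rw [div_le_one hy]; exact h)
  · have hint : IntegrableOn (fun s : ℝ => s⁻¹) (Ioo y ε) := by
      have : ContinuousOn (fun s : ℝ => s⁻¹) (Icc y ε) :=
        continuousOn_inv₀.mono fun s hs => (hy.trans_le hs.1).ne'
      exact (this.integrableOn_Icc).mono_set Ioo_subset_Icc_self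
    rw [← integral_inv_of_pos hy hε, intervalIntegral.integral_of_le h.le,
      integral_Ioc_eq_integral_Ioo, ofReal_integral_eq_lintegral_ofReal hint]
    filter_upwards [ae_restrict_mem measurableSet_Ioo] with s hs
    exact inv_nonneg.2 (hy.trans hs.1).le

lemma enorm_log_one_sub_le {ε : ℝ} (hε : 0 < ε) {ζ : ℂ} (hζ : ‖ζ‖ < 1) :
    ‖Complex.log (1 - ζ)‖ₑ ≤ ENNReal.ofReal (Real.log (ε / (2 * Real.pi * ‖1 - ζ‖))) +
      ENNReal.ofReal (Real.pi + Real.log 2 + |Real.log (2 * Real.pi / ε)|) := by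
  have hx0 : 0 < ‖1 - ζ‖ := by
    have := norm_sub_norm_le 1 ζ
    simp only [norm_one] at this
    linarith
  have hx2 : ‖1 - ζ‖ ≤ 2 := by
    have := norm_sub_le 1 ζ
    simp only [norm_one] at this
    linarith
  have h1 : ‖Complex.log (1 - ζ)‖ ≤ |Real.log ‖1 - ζ‖| + Real.pi := by
    have := Complex.norm_le_abs_re_add_abs_im (Complex.log (1 - ζ))
    rw [Complex.log_re, Complex.log_im] at this
    linarith [Complex.abs_arg_le_pi (1 - ζ)]
  have hpi := Real.pi_pos
  have h2 : Real.log (ε / (2 * Real.pi * ‖1 - ζ‖)) =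
      - Real.log (2 * Real.pi / ε) - Real.log ‖1 - ζ‖ := by
    rw [Real.log_div, Real.log_mul, Real.log_div] <;> first | positivity | ring
  have hl2 : 0 ≤ Real.log 2 := Real.log_nonneg (by norm_num)
  have h3 : Real.log ‖1 - ζ‖ ≤ Real.log 2 := Real.log_le_log hx0 hx2
  rw [← ofReal_norm]
  have h4 := le_abs_self (Real.log (2 * Real.pi / ε))
  have h5 := abs_nonneg (Real.log (2 * Real.pi / ε))
  rcases le_total 0 (Real.log ‖1 - ζ‖) with h | h
  · rw [abs_of_nonneg h] at h1
    exact (ENNReal.ofReal_le_ofReal (by linarith)).trans le_add_self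
  · rw [abs_of_nonpos h] at h1
    refine le_trans (ENNReal.ofReal_le_ofReal ?_) ENNReal.ofReal_add_le
    linarith

lemma norm_mul_conj_lt_one {z w : ℂ} (hz : ‖z‖ < 1) (hw : ‖w‖ < 1) :
    ‖z * starRingEnd ℂ w‖ < 1 := by
  rw [norm_mul, RCLike.norm_conj]
  nlinarith [norm_nonneg z, norm_nonneg w]

/-- The logarithmic potential of `μ` is bounded under the one-box condition. -/
lemma exists_lintegral_log_le (μ : Measure ℂ) [IsFiniteMeasure μ]
    (hμsupp : μ (Metric.ball (0:ℂ) 1)ᶜ = 0) (φ : ℝ → ℝ)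
    (hφint : ∫⁻ x in Set.Ioc (0:ℝ) (2 * Real.pi), ENNReal.ofReal (φ x / x) < ⊤)
    (C ε : ℝ) (hC : 0 < C) (hε : 0 < ε) (hε' : ε ≤ 2 * Real.pi)
    (hbox : ∀ θ ℓ : ℝ, 0 < ℓ → ℓ < ε →
      μ (carlesonBox θ ℓ) ≤ ENNReal.ofReal (C * φ ℓ)) :
    ∃ M : ℝ, 0 < M ∧ ∀ w ∈ Metric.ball (0:ℂ) 1,
      ∫⁻ z, ‖Complex.log (1 - z * starRingEnd ℂ w)‖ₑ ∂μ ≤ ENNReal.ofReal M := by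
  have hpi := Real.pi_pos
  set A := ENNReal.ofReal (Real.pi + Real.log 2 + |Real.log (2 * Real.pi / ε)|)
  set J := ∫⁻ x in Set.Ioc (0:ℝ) (2 * Real.pi), ENNReal.ofReal (φ x / x)
  set B := ENNReal.ofReal C * J + A * μ univ
  have hB : B ≠ ⊤ := by
    refine ENNReal.add_ne_top.2 ⟨ENNReal.mul_ne_top ENNReal.ofReal_ne_top hφint.ne, ?_⟩
    exact ENNReal.mul_ne_top ENNReal.ofReal_ne_top (measure_ne_top _ _)
  refine ⟨B.toReal + 1, by positivity, fun w hw => ?_⟩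
  have hw1 : ‖w‖ < 1 := by simpa using hw
  have hμae : ∀ᵐ z ∂μ, ‖z‖ < 1 := by
    rw [ae_iff]
    convert hμsupp using 2
    ext z; simp
  suffices h : ∫⁻ z, ‖Complex.log (1 - z * starRingEnd ℂ w)‖ₑ ∂μ ≤ B by
    refine h.trans ?_
    rw [← ENNReal.ofReal_toReal hB]
    exact ENNReal.ofReal_le_ofReal (by rw [ENNReal.toReal_ofReal ENNReal.toReal_nonneg]; linarith)
  have hlt : ∀ z : ℂ, ‖z‖ < 1 → ‖z * starRingEnd ℂ w‖ < 1 :=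
    fun z hz => norm_mul_conj_lt_one hz hw1
  obtain ⟨β, hβ⟩ := exists_carlesonBox_superset w hw1
  set y : ℂ → ℝ := fun z => 2 * Real.pi * ‖1 - z * starRingEnd ℂ w‖
  have hyc : Continuous y := by fun_prop
  have hmeas : Measurable (fun p : ℂ × ℝ =>
      (Ioi (y p.1)).indicator (fun s => ENNReal.ofReal s⁻¹) p.2) := by
    have : (fun p : ℂ × ℝ => (Ioi (y p.1)).indicator (fun s => ENNReal.ofReal s⁻¹) p.2) =
        {p : ℂ × ℝ | y p.1 < p.2}.indicator (fun p => ENNReal.ofReal p.2⁻¹) := by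
      ext p; simp [indicator]
    rw [this]
    refine Measurable.indicator (by fun_prop) ?_
    exact measurableSet_lt (by fun_prop) (by fun_prop)
  calc ∫⁻ z, ‖Complex.log (1 - z * starRingEnd ℂ w)‖ₑ ∂μ
      ≤ ∫⁻ z, (∫⁻ s in Ioo 0 ε, (Ioi (y z)).indicator (fun s => ENNReal.ofReal s⁻¹) s)
          + A ∂μ := by
        refine lintegral_mono_ae ?_
        filter_upwards [hμae] with z hz
        have hy : 0 < y z := by
          have h1 := norm_sub_norm_le 1 (z * starRingEnd ℂ w)
          have h2 := hlt z hz
          simp only [norm_one] at h1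
          have : 0 < ‖1 - z * starRingEnd ℂ w‖ := by linarith
          positivity
        rw [← ofReal_log_div_eq_lintegral hε hy]
        exact enorm_log_one_sub_le hε (hlt z hz)
    _ = (∫⁻ s in Ioo 0 ε, ∫⁻ z, (Ioi (y z)).indicator (fun s => ENNReal.ofReal s⁻¹) s ∂μ)
          + A * μ univ := by
        rw [lintegral_add_right _ measurable_const, lintegral_const]
        congr 1
        exact lintegral_lintegral_swap hmeas.aemeasurable
    _ ≤ B := by
        refine add_le_add ?_ le_rfl
        rw [← lintegral_const_mul' _ _ ENNReal.ofReal_ne_top]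
        refine le_trans (setLIntegral_mono' measurableSet_Ioo fun s hs => ?_)
          (lintegral_mono_set (Ioo_subset_Ioc_self.trans (Ioc_subset_Ioc_right hε')))
        have hs0 : 0 < s := hs.1
        calc ∫⁻ z, (Ioi (y z)).indicator (fun s => ENNReal.ofReal s⁻¹) s ∂μ
            = ∫⁻ z, {z | y z < s}.indicator (fun _ => ENNReal.ofReal s⁻¹) z ∂μ := by
              simp [indicator]
          _ = ENNReal.ofReal s⁻¹ * μ {z | y z < s} := by
              rw [lintegral_indicator_const (measurableSet_lt (by fun_prop) (by fun_prop))]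
          _ ≤ ENNReal.ofReal s⁻¹ * ENNReal.ofReal (C * φ s) := by
              gcongr
              refine le_trans (measure_mono_ae ?_) (hbox (β - s / 2) s hs.1 hs.2)
              filter_upwards [hμae] with z hz hzs
              exact hβ s ⟨hz, hzs⟩
          _ = ENNReal.ofReal C * ENNReal.ofReal (φ s / s) := by
              rw [← ENNReal.ofReal_mul (by positivity), ← ENNReal.ofReal_mul hC.le]
              congr 1
              field_simp

/-- Taylor coefficients of a holomorphic function on the unit disk and of its derivative. -/
lemma exists_hasSum_coeff {f : ℂ → ℂ} (hf : DifferentiableOn ℂ f (Metric.ball (0:ℂ) 1)) :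
    ∃ a : ℕ → ℂ, (∀ z ∈ Metric.ball (0:ℂ) 1, HasSum (fun n => a n * z ^ (n + 1)) (f z - f 0)) ∧
      ∀ z ∈ Metric.ball (0:ℂ) 1, HasSum (fun n : ℕ => ((n : ℂ) + 1) * a n * z ^ n) (deriv f z) := by
  refine ⟨fun n => ((n + 1).factorial : ℂ)⁻¹ * iteratedDeriv (n + 1) f 0, fun z hz => ?_,
    fun z hz => ?_⟩
  · have h := Complex.hasSum_taylorSeries_on_ball hf hz
    rw [← hasSum_nat_add_iff' 1] at h
    simp only [sub_zero, smul_eq_mul, Finset.range_one, Finset.sum_singleton,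
      Nat.factorial_zero, Nat.cast_one, inv_one, pow_zero, one_mul, iteratedDeriv_zero] at h
    convert! h using 2 with n
    ring
  · have h := Complex.hasSum_taylorSeries_on_ball (hf.deriv Metric.isOpen_ball) hz
    simp only [sub_zero, smul_eq_mul, ← iteratedDeriv_succ'] at h
    convert! h using 2 with n
    beta_reduce
    rw [Nat.factorial_succ]
    have h1 : ((n : ℂ) + 1) ≠ 0 := by exact_mod_cast n.succ_ne_zero
    push_cast
    field_simp

/-- Bessel's inequality for an absolutely convergent power series on the unit circle. -/
lemma sum_norm_sq_le_circleAverage {b : ℕ → ℂ} {F : ℂ → ℂ} (hb : Summable fun n => ‖b n‖)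
    (hF : ∀ z : ℂ, ‖z‖ = 1 → HasSum (fun n => b n * z ^ n) (F z)) (N : ℕ) :
    ∑ n ∈ Finset.range N, ‖b n‖ ^ 2 ≤ Real.circleAverage (fun z => ‖F z‖ ^ 2) 0 1 := by
  have hpoly : ∀ k : ℕ, ∑ n ∈ Finset.range k, ‖b n‖ ^ 2 =
      Real.circleAverage (fun z => ‖∑ n ∈ Finset.range k, b n * z ^ n‖ ^ 2) 0 1 := by
    intro k
    have h := Polynomial.sum_sq_norm_coeff_eq_circleAverage
      (∑ n ∈ Finset.range k, Polynomial.monomial n (b n))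
    have hcoeff : ∀ i, (∑ n ∈ Finset.range k, Polynomial.monomial n (b n)).coeff i =
        if i < k then b i else 0 := by
      intro i
      simp [Polynomial.finsetSum_coeff, Polynomial.coeff_monomial]
    simp only [hcoeff, Polynomial.eval_finsetSum, Polynomial.eval_monomial] at h
    rw [← h]
    symm
    rw [Finset.sum_subset (s₂ := Finset.range k)]
    · refine Finset.sum_congr rfl fun i hi => ?_
      rw [if_pos (Finset.mem_range.1 hi)]
    · intro i hi
      rw [Polynomial.mem_support_iff, hcoeff] at hi
      by_contra h'
      exact hi (if_neg (by simpa using h'))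
    · intro i _ hi
      rw [Polynomial.notMem_support_iff, hcoeff] at hi
      rw [hi]; simp
  have hcirc : ∀ θ : ℝ, ‖circleMap 0 1 θ‖ = 1 := fun θ => by simp
  have hbound : ∀ (k : ℕ) (z : ℂ), ‖z‖ = 1 →
      ‖∑ n ∈ Finset.range k, b n * z ^ n‖ ≤ ∑' n, ‖b n‖ := by
    intro k z hz
    refine (norm_sum_le _ _).trans ?_
    simp only [norm_mul, norm_pow, hz, one_pow, mul_one]
    exact hb.sum_le_tsum _ fun _ _ => norm_nonneg _
  have hlim : Tendsto (fun k => ∑ n ∈ Finset.range k, ‖b n‖ ^ 2) atTop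
      (nhds (Real.circleAverage (fun z => ‖F z‖ ^ 2) 0 1)) := by
    simp only [hpoly, Real.circleAverage_def]
    refine Tendsto.const_smul ?_ _
    refine intervalIntegral.tendsto_integral_filter_of_dominated_convergence
      (fun _ => (∑' n, ‖b n‖) ^ 2) (Eventually.of_forall fun k => ?_)
      (Eventually.of_forall fun k => Eventually.of_forall fun θ _ => ?_) (by simp)
      (Eventually.of_forall fun θ _ => ?_)
    · exact Continuous.aestronglyMeasurable (by fun_prop)
    · rw [Real.norm_of_nonneg (by positivity)]
      gcongr
      exact hbound k _ (hcirc θ)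
    · exact ((hF _ (hcirc θ)).tendsto_sum_nat.norm).pow 2
  refine ge_of_tendsto hlim (eventually_atTop.2 ⟨N, fun k hk => ?_⟩)
  exact Finset.sum_le_sum_of_subset_of_nonneg (Finset.range_mono hk) fun _ _ _ => by positivity

lemma summable_norm_mul_pow_of_hasSum {b : ℕ → ℂ} {g : ℂ → ℂ}
    (hg : ∀ z ∈ Metric.ball (0:ℂ) 1, HasSum (fun n => b n * z ^ n) (g z)) {r : ℝ}
    (hr0 : 0 ≤ r) (hr1 : r < 1) : Summable fun n => ‖b n * (r : ℂ) ^ n‖ :=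
  (hg r (by simpa [abs_of_nonneg hr0] using hr1)).summable.norm

lemma sum_norm_sq_mul_pow_le_lintegral {b : ℕ → ℂ} {g : ℂ → ℂ}
    (hg : ∀ z ∈ Metric.ball (0:ℂ) 1, HasSum (fun n => b n * z ^ n) (g z))
    (hgc : ContinuousOn g (Metric.ball (0:ℂ) 1)) (N : ℕ) {r : ℝ} (hr0 : 0 ≤ r) (hr1 : r < 1) :
    ENNReal.ofReal (2 * Real.pi * ∑ n ∈ Finset.range N, ‖b n‖ ^ 2 * r ^ (2 * n)) ≤
      ∫⁻ θ in Ioo (-Real.pi) Real.pi,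
        ENNReal.ofReal (‖g (Complex.polarCoord.symm (r, θ))‖ ^ 2) := by
  have hpi := Real.pi_pos
  have hmem : ∀ z : ℂ, ‖z‖ = 1 → (r : ℂ) * z ∈ Metric.ball (0:ℂ) 1 := by
    intro z hz
    simpa [hz, abs_of_nonneg hr0] using hr1
  have h := sum_norm_sq_le_circleAverage (F := fun z => g (r * z))
    (summable_norm_mul_pow_of_hasSum hg hr0 hr1) (fun z hz => by
      have := hg _ (hmem z hz)
      simpa only [mul_pow, mul_assoc] using this) N
  have hpt : ∀ θ : ℝ, (r : ℂ) * circleMap 0 1 θ = Complex.polarCoord.symm (r, θ) := by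
    intro θ
    simp [circleMap, Complex.exp_mul_I]
  rw [Real.circleAverage_eq_integral_add (-Real.pi),
    intervalIntegral.integral_comp_add_right
      (fun θ => ‖g (r * circleMap 0 1 θ)‖ ^ 2)] at h
  simp only [hpt] at h
  rw [show 0 + -Real.pi = -Real.pi by ring, show 2 * Real.pi + -Real.pi = Real.pi by ring,
    smul_eq_mul, inv_mul_eq_div, le_div_iff₀ (by positivity),
    intervalIntegral.integral_of_le (by linarith)] at h
  have hcont : Continuous fun θ : ℝ => ‖g (Complex.polarCoord.symm (r, θ))‖ ^ 2 := by
    simp only [← hpt]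
    refine (Continuous.norm ?_).pow 2
    exact hgc.comp_continuous (by fun_prop) fun θ => hmem _ (by simp)
  rw [integral_Ioc_eq_integral_Ioo] at h
  rw [← ofReal_integral_eq_lintegral_ofReal
    ((hcont.integrableOn_Icc).mono_set Ioo_subset_Icc_self)
    (Eventually.of_forall fun _ => by positivity)]
  refine ENNReal.ofReal_le_ofReal (le_trans (le_of_eq ?_) h)
  rw [mul_comm]
  congr 1
  refine Finset.sum_congr rfl fun n _ => ?_
  rw [norm_mul, norm_pow, Complex.norm_real, Real.norm_of_nonneg hr0]
  ring

/-- Bessel's inequality for the monomials in the Bergman space of the disk. -/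
lemma sum_norm_sq_div_le_lintegral_ball {b : ℕ → ℂ} {g : ℂ → ℂ}
    (hg : ∀ z ∈ Metric.ball (0:ℂ) 1, HasSum (fun n => b n * z ^ n) (g z))
    (hgc : ContinuousOn g (Metric.ball (0:ℂ) 1)) (hgm : Measurable g) (N : ℕ) :
    ENNReal.ofReal (Real.pi * ∑ n ∈ Finset.range N, ‖b n‖ ^ 2 / (n + 1)) ≤
      ∫⁻ z in Metric.ball (0:ℂ) 1, ENNReal.ofReal (‖g z‖ ^ 2) := by
  have hpi := Real.pi_pos
  rw [← lintegral_indicator Metric.isOpen_ball.measurableSet,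
    ← Complex.lintegral_comp_polarCoord_symm]
  set G := (Metric.ball (0:ℂ) 1).indicator fun z => ENNReal.ofReal (‖g z‖ ^ 2)
  have hsub : Ioo (0:ℝ) 1 ×ˢ Ioo (-Real.pi) Real.pi ⊆ polarCoord.target :=
    prod_mono Ioo_subset_Ioi_self subset_rfl
  have hGm : Measurable G :=
    Measurable.indicator (by fun_prop) Metric.isOpen_ball.measurableSet
  have hpm : Measurable fun p : ℝ × ℝ => Complex.polarCoord.symm p := by
    simp only [Complex.polarCoord_symm_apply]
    fun_prop
  refine le_trans ?_ (lintegral_mono_set hsub)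
  rw [Measure.volume_eq_prod, ← Measure.prod_restrict, lintegral_prod _ (by
    refine Measurable.aemeasurable ?_
    simp only [smul_eq_mul]
    exact (by fun_prop : Measurable fun p : ℝ × ℝ => ENNReal.ofReal p.1).mul (hGm.comp hpm))]
  have hinner : ∀ r ∈ Ioo (0:ℝ) 1,
      ENNReal.ofReal (2 * Real.pi * ∑ n ∈ Finset.range N, ‖b n‖ ^ 2 * r ^ (2 * n + 1)) ≤
      ∫⁻ θ in Ioo (-Real.pi) Real.pi,
        ENNReal.ofReal (r, θ).1 • G (Complex.polarCoord.symm (r, θ)) := by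
    intro r hr
    have hG : ∀ θ : ℝ, G (Complex.polarCoord.symm (r, θ)) =
        ENNReal.ofReal (‖g (Complex.polarCoord.symm (r, θ))‖ ^ 2) := by
      intro θ
      refine indicator_of_mem ?_ _
      rw [mem_ball_zero_iff, Complex.norm_polarCoord_symm, abs_of_pos hr.1]
      exact hr.2
    simp only [hG, smul_eq_mul]
    rw [lintegral_const_mul' _ _ ENNReal.ofReal_ne_top]
    refine le_trans (le_of_eq ?_)
      (mul_le_mul_right (sum_norm_sq_mul_pow_le_lintegral hg hgc N hr.1.le hr.2) _)
    rw [← ENNReal.ofReal_mul hr.1.le]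
    congr 1
    rw [Finset.mul_sum, Finset.mul_sum, Finset.mul_sum]
    refine Finset.sum_congr rfl fun n _ => by ring
  refine le_trans (le_of_eq ?_) (setLIntegral_mono' measurableSet_Ioo hinner)
  have hcont : Continuous fun r : ℝ =>
      2 * Real.pi * ∑ n ∈ Finset.range N, ‖b n‖ ^ 2 * r ^ (2 * n + 1) := by fun_prop
  rw [← ofReal_integral_eq_lintegral_ofReal
    ((hcont.integrableOn_Icc).mono_set Ioo_subset_Icc_self), ← integral_Ioc_eq_integral_Ioo,
    ← intervalIntegral.integral_of_le zero_le_one]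
  · congr 1
    rw [intervalIntegral.integral_const_mul, intervalIntegral.integral_finsetSum
      fun n _ => Continuous.intervalIntegrable (by fun_prop) _ _, Finset.mul_sum, Finset.mul_sum]
    refine Finset.sum_congr rfl fun n _ => ?_
    rw [intervalIntegral.integral_const_mul, integral_pow]
    have : (n : ℝ) + 1 ≠ 0 := by positivity
    push_cast
    simp only [one_pow, ne_eq, Nat.add_eq_zero_iff, one_ne_zero, and_false, not_false_eq_true,
      zero_pow, sub_zero]
    field_simp
    ring
  · filter_upwards [ae_restrict_mem measurableSet_Ioo] with r hr
    have := hr.1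
    simp only [Pi.zero_apply]
    positivity

/-- The coefficient form of the Dirichlet integral is at most the Dirichlet integral. -/
lemma sum_coeff_le_dirichlet {f : ℂ → ℂ} (hf : InDirichlet f) {a : ℕ → ℂ}
    (ha : ∀ z ∈ Metric.ball (0:ℂ) 1,
      HasSum (fun n : ℕ => ((n : ℂ) + 1) * a n * z ^ n) (deriv f z)) (N : ℕ) :
    ∑ n ∈ Finset.range N, ((n : ℝ) + 1) * ‖a n‖ ^ 2 ≤
      (1 / Real.pi) * ∫ z in Metric.ball (0:ℂ) 1, ‖deriv f z‖ ^ 2 := by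
  have hpi := Real.pi_pos
  have h := sum_norm_sq_div_le_lintegral_ball ha
    (hf.1.deriv Metric.isOpen_ball).continuousOn (measurable_deriv f) N
  rw [← ofReal_integral_eq_lintegral_ofReal hf.2 (Eventually.of_forall fun _ => by positivity),
    ENNReal.ofReal_le_ofReal_iff (integral_nonneg fun _ => by positivity)] at h
  rw [one_div, inv_mul_eq_div, le_div_iff₀ hpi]
  refine le_trans (le_of_eq ?_) h
  rw [mul_comm]
  congr 1
  refine Finset.sum_congr rfl fun n _ => ?_
  have hn : ‖(n : ℂ) + 1‖ = n + 1 := by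
    rw [← Nat.cast_succ, Complex.norm_natCast, Nat.cast_succ]
  rw [norm_mul, hn]
  have : (n : ℝ) + 1 ≠ 0 := by positivity
  field_simp

lemma two_mul_enorm_mul_le (x y : ℂ) : 2 * (‖x‖ₑ * ‖y‖ₑ) ≤ ‖x‖ₑ ^ 2 + ‖y‖ₑ ^ 2 := by
  have h := two_mul_le_add_sq ‖x‖₊ ‖y‖₊
  rw [mul_assoc] at h
  simp only [enorm_eq_nnnorm]
  exact_mod_cast h

lemma enorm_log_one_sub_mul_conj_comm {z w : ℂ} (hz : ‖z‖ < 1) (hw : ‖w‖ < 1) :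
    ‖Complex.log (1 - z * starRingEnd ℂ w)‖ₑ = ‖Complex.log (1 - w * starRingEnd ℂ z)‖ₑ := by
  have hconj : 1 - w * starRingEnd ℂ z = starRingEnd ℂ (1 - z * starRingEnd ℂ w) := by
    simp [mul_comm]
  have hlt := norm_mul_conj_lt_one hz hw
  have hre : 0 < (1 - z * starRingEnd ℂ w).re := by
    have := Complex.re_le_norm (z * starRingEnd ℂ w)
    rw [Complex.sub_re, Complex.one_re]
    linarith
  have harg : (1 - z * starRingEnd ℂ w).arg ≠ Real.pi := fun h => by
    have := (Complex.arg_eq_pi_iff.1 h).1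
    linarith
  rw [hconj, Complex.log_conj _ harg, ← ofReal_norm, ← ofReal_norm, RCLike.norm_conj]

/-- Schur test for the kernel `log (1 - z w̄)`. -/
lemma norm_integral_log_kernel_le (ν : Measure ℂ) [IsFiniteMeasure ν]
    (hν : ∀ᵐ z ∂ν, ‖z‖ < 1) {M : ℝ} (hM : 0 ≤ M)
    (hpot : ∀ w ∈ Metric.ball (0:ℂ) 1,
      ∫⁻ z, ‖Complex.log (1 - z * starRingEnd ℂ w)‖ₑ ∂ν ≤ ENNReal.ofReal M)
    {g : ℂ → ℂ} (hgm : AEStronglyMeasurable g ν) (hg2 : Integrable (fun z => ‖g z‖ ^ 2) ν) :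
    ‖∫ p, starRingEnd ℂ (g p.1) * g p.2 *
      -Complex.log (1 - p.1 * starRingEnd ℂ p.2) ∂ν.prod ν‖ ≤ M * ∫ z, ‖g z‖ ^ 2 ∂ν := by
  set L : ℂ × ℂ → ENNReal := fun p => ‖Complex.log (1 - p.1 * starRingEnd ℂ p.2)‖ₑ
  have hLm : Measurable L := by
    have h1 : Measurable fun p : ℂ × ℂ => 1 - p.1 * starRingEnd ℂ p.2 :=
      Continuous.measurable (by fun_prop)
    exact (Complex.measurable_log.comp h1).enorm
  have hE : AEMeasurable (fun z => ‖g z‖ₑ ^ 2) ν := hgm.enorm.pow_const 2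
  have hfm : AEMeasurable (fun p : ℂ × ℂ => ‖g p.1‖ₑ ^ 2 * L p) (ν.prod ν) :=
    hE.comp_fst.mul hLm.aemeasurable
  have hsm : AEMeasurable (fun p : ℂ × ℂ => ‖g p.2‖ₑ ^ 2 * L p) (ν.prod ν) :=
    hE.comp_snd.mul hLm.aemeasurable
  have hX : ∫⁻ z, ‖g z‖ₑ ^ 2 ∂ν = ENNReal.ofReal (∫ z, ‖g z‖ ^ 2 ∂ν) := by
    rw [ofReal_integral_eq_lintegral_ofReal hg2 (Eventually.of_forall fun _ => by positivity)]
    simp only [ENNReal.ofReal_pow (norm_nonneg _), ofReal_norm]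
  have hfst : ∫⁻ p, ‖g p.1‖ₑ ^ 2 * L p ∂ν.prod ν ≤
      ENNReal.ofReal M * ∫⁻ z, ‖g z‖ₑ ^ 2 ∂ν := by
    rw [lintegral_prod _ hfm,
      ← lintegral_const_mul' _ _ ENNReal.ofReal_ne_top]
    refine lintegral_mono_ae ?_
    filter_upwards [hν] with z hz
    rw [lintegral_const_mul _ (by fun_prop), mul_comm]
    gcongr
    refine le_trans (le_of_eq (lintegral_congr_ae ?_)) (hpot z (by simpa using hz))
    filter_upwards [hν] with w hw
    exact enorm_log_one_sub_mul_conj_comm hz hw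
  have hsnd : ∫⁻ p, ‖g p.2‖ₑ ^ 2 * L p ∂ν.prod ν ≤
      ENNReal.ofReal M * ∫⁻ z, ‖g z‖ₑ ^ 2 ∂ν := by
    rw [lintegral_prod_symm _ hsm,
      ← lintegral_const_mul' _ _ ENNReal.ofReal_ne_top]
    refine lintegral_mono_ae ?_
    filter_upwards [hν] with w hw
    rw [lintegral_const_mul _ (by fun_prop), mul_comm]
    gcongr
    exact hpot w (by simpa using hw)
  have hX0 : 0 ≤ ∫ z, ‖g z‖ ^ 2 ∂ν := integral_nonneg fun _ => by positivity
  have hmain : 2 * ‖∫ p, starRingEnd ℂ (g p.1) * g p.2 *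
      -Complex.log (1 - p.1 * starRingEnd ℂ p.2) ∂ν.prod ν‖ₑ ≤
      2 * ENNReal.ofReal (M * ∫ z, ‖g z‖ ^ 2 ∂ν) := by
    calc _ ≤ 2 * ∫⁻ p, ‖g p.1‖ₑ * ‖g p.2‖ₑ * L p ∂ν.prod ν := by
          gcongr
          refine (enorm_integral_le_lintegral_enorm _).trans (le_of_eq ?_)
          refine lintegral_congr fun p => ?_
          rw [enorm_mul, enorm_mul, enorm_neg, RCLike.enorm_conj]
      _ = ∫⁻ p, 2 * (‖g p.1‖ₑ * ‖g p.2‖ₑ * L p) ∂ν.prod ν := by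
          rw [lintegral_const_mul' _ _ (by simp)]
      _ ≤ ∫⁻ p, (‖g p.1‖ₑ ^ 2 * L p + ‖g p.2‖ₑ ^ 2 * L p) ∂ν.prod ν := by
          refine lintegral_mono fun p => ?_
          rw [← add_mul, ← mul_assoc]
          gcongr
          exact two_mul_enorm_mul_le _ _
      _ ≤ _ := by
          rw [lintegral_add_left' hfm, two_mul,
            ENNReal.ofReal_mul hM, ← hX]
          exact add_le_add hfst hsnd
  rw [ENNReal.mul_le_mul_iff_right (by simp) (by simp), ← ofReal_norm,
    ENNReal.ofReal_le_ofReal_iff (by positivity)] at hmain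
  exact hmain

/-- The Carleson embedding estimate for a measure carried by a compact subset of the disk. -/
lemma integral_norm_sq_le (ν : Measure ℂ) [IsFiniteMeasure ν] {R : ℝ} (hR0 : 0 ≤ R)
    (hR1 : R < 1) (hν : ∀ᵐ z ∂ν, ‖z‖ ≤ R) {M : ℝ} (hM : 0 < M)
    (hpot : ∀ w ∈ Metric.ball (0:ℂ) 1,
      ∫⁻ z, ‖Complex.log (1 - z * starRingEnd ℂ w)‖ₑ ∂ν ≤ ENNReal.ofReal M)
    {g : ℂ → ℂ} {a : ℕ → ℂ} (hgm : AEStronglyMeasurable g ν)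
    (hg : ∀ z ∈ Metric.ball (0:ℂ) 1, HasSum (fun n => a n * z ^ (n + 1)) (g z)) {D : ℝ}
    (ha : ∀ N, ∑ n ∈ Finset.range N, ((n : ℝ) + 1) * ‖a n‖ ^ 2 ≤ D) :
    Integrable (fun z => ‖g z‖ ^ 2) ν ∧ ∫ z, ‖g z‖ ^ 2 ∂ν ≤ M * D := by
  have hνlt : ∀ᵐ z ∂ν, ‖z‖ < 1 := hν.mono fun z hz => hz.trans_lt hR1
  have hsum : Summable fun n => ‖a n‖ * R ^ (n + 1) := by
    have := (hg (R : ℂ) (by simpa [abs_of_nonneg hR0] using hR1)).summable.norm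
    simpa [abs_of_nonneg hR0] using this
  set G := ∑' n, ‖a n‖ * R ^ (n + 1)
  have hG0 : 0 ≤ G := tsum_nonneg fun n => by positivity
  have hgG : ∀ᵐ z ∂ν, ‖g z‖ ≤ G := by
    filter_upwards [hν] with z hz
    rw [← (hg z (by simpa using hz.trans_lt hR1)).tsum_eq]
    refine tsum_of_norm_bounded hsum.hasSum fun n => ?_
    rw [norm_mul, norm_pow]
    gcongr
  have hg2 : Integrable (fun z => ‖g z‖ ^ 2) ν := by
    refine Integrable.of_bound (hgm.norm.pow 2) (G ^ 2) ?_
    filter_upwards [hgG] with z hz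
    rw [Real.norm_of_nonneg (by positivity)]
    gcongr
  refine ⟨hg2, ?_⟩
  set X := ∫ z, ‖g z‖ ^ 2 ∂ν
  set c : ℕ → ℂ := fun n => ∫ z, z ^ (n + 1) * starRingEnd ℂ (g z) ∂ν
  have hcm : AEStronglyMeasurable (fun z => starRingEnd ℂ (g z)) ν :=
    Complex.continuous_conj.comp_aestronglyMeasurable hgm
  -- Pairing `g` with itself in terms of its coefficients.
  have hpair : HasSum (fun n => a n * c n) (X : ℂ) := by
    have h := hasSum_integral_of_dominated_convergence (μ := ν)
      (F := fun (n : ℕ) z => a n * (z ^ (n + 1) * starRingEnd ℂ (g z)))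
      (f := fun z => g z * starRingEnd ℂ (g z))
      (fun n _ => ‖a n‖ * R ^ (n + 1) * G)
      (fun n => ((Continuous.aestronglyMeasurable (by fun_prop)).mul hcm).const_mul _)
      (fun n => by
        filter_upwards [hν, hgG] with z hz hz'
        rw [norm_mul, norm_mul, norm_pow, RCLike.norm_conj, ← mul_assoc]
        gcongr)
      (Eventually.of_forall fun _ => hsum.mul_right _) (integrable_const _)
      (by
        filter_upwards [hνlt] with z hz
        simpa only [mul_assoc] using (hg z (by simpa using hz)).mul_right _)
    simp only [integral_const_mul, Complex.mul_conj'] at h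
    convert! h using 1
    rw [← integral_complex_ofReal]
    simp
  -- The dual norm of the functional defined by `g`.
  have hdual : HasSum (fun n : ℕ => ((‖c n‖ ^ 2 / (n + 1) : ℝ) : ℂ))
      (∫ p, starRingEnd ℂ (g p.1) * g p.2 *
        -Complex.log (1 - p.1 * starRingEnd ℂ p.2) ∂ν.prod ν) := by
    have hpR : ∀ᵐ p ∂ν.prod ν, (‖p.1‖ ≤ R ∧ ‖g p.1‖ ≤ G) ∧ ‖p.2‖ ≤ R ∧ ‖g p.2‖ ≤ G := by
      have h := hν.and hgG
      exact (Measure.quasiMeasurePreserving_fst.ae h).and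
        (Measure.quasiMeasurePreserving_snd.ae h)
    have hgeom : Summable fun n : ℕ => R ^ (n + 1) * (G * G) := by
      have := (summable_geometric_of_lt_one hR0 hR1).mul_right (R * (G * G))
      exact this.congr fun n => by ring
    have h := hasSum_integral_of_dominated_convergence (μ := ν.prod ν)
      (F := fun (n : ℕ) p => (n + 1 : ℂ)⁻¹ * ((p.1 ^ (n + 1) * starRingEnd ℂ (g p.1)) *
        starRingEnd ℂ (p.2 ^ (n + 1) * starRingEnd ℂ (g p.2))))
      (f := fun p => starRingEnd ℂ (g p.1) * g p.2 *
        -Complex.log (1 - p.1 * starRingEnd ℂ p.2))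
      (fun n _ => R ^ (n + 1) * (G * G))
      (fun n => by
        have h1 : AEStronglyMeasurable (fun z => z ^ (n + 1) * starRingEnd ℂ (g z)) ν :=
          (Continuous.aestronglyMeasurable (by fun_prop)).mul hcm
        exact (h1.comp_fst.mul
          (Complex.continuous_conj.comp_aestronglyMeasurable h1.comp_snd)).const_mul _)
      (fun n => by
        filter_upwards [hpR] with p hp
        obtain ⟨⟨h1, h2⟩, h3, h4⟩ := hp
        have hn : ‖(n + 1 : ℂ)⁻¹‖ ≤ 1 := by
          rw [← Nat.cast_succ, norm_inv, Complex.norm_natCast]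
          exact inv_le_one_of_one_le₀ (by simp)
        have h5 : ‖p.2‖ ^ (n + 1) ≤ 1 := pow_le_one₀ (norm_nonneg _) (h3.trans hR1.le)
        simp only [norm_mul, norm_pow, RCLike.norm_conj]
        calc ‖(n + 1 : ℂ)⁻¹‖ * (‖p.1‖ ^ (n + 1) * ‖g p.1‖ * (‖p.2‖ ^ (n + 1) * ‖g p.2‖))
            ≤ 1 * (R ^ (n + 1) * G * (1 * G)) := by gcongr
          _ = _ := by ring)
      (Eventually.of_forall fun _ => hgeom) (integrable_const _)
      (by
        filter_upwards [hpR] with p hp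
        have hlt := norm_mul_conj_lt_one (hp.1.1.trans_lt hR1) (hp.2.1.trans_lt hR1)
        have := (Complex.hasSum_taylorSeries_neg_log' hlt).mul_left
          (starRingEnd ℂ (g p.1) * g p.2)
        convert! this using 2 with n
        simp only [map_mul, map_pow, Complex.conj_conj]
        ring)
    convert! h using 2 with n
    rw [integral_const_mul, integral_prod_mul (fun z => z ^ (n + 1) * starRingEnd ℂ (g z))
      (fun z => starRingEnd ℂ (z ^ (n + 1) * starRingEnd ℂ (g z))), integral_conj,
      Complex.mul_conj']
    push_cast
    ring
  have hX0 : 0 ≤ X := integral_nonneg fun _ => by positivity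
  have hY : ∀ N, ∑ n ∈ Finset.range N, ‖c n‖ ^ 2 / ((n : ℝ) + 1) ≤ M * X := by
    intro N
    have hre := Complex.hasSum_re hdual
    simp only [Complex.ofReal_re] at hre
    refine (sum_le_hasSum _ (fun n _ => by positivity) hre).trans ?_
    exact (Complex.re_le_norm _).trans
      (norm_integral_log_kernel_le ν hνlt hM.le hpot hgm hg2)
  have hfin : ∀ N, ‖∑ n ∈ Finset.range N, a n * c n‖ ≤ M * D / 2 + X / 2 := by
    intro N
    have hterm : ∀ n : ℕ, ‖a n * c n‖ ≤
        M / 2 * (((n : ℝ) + 1) * ‖a n‖ ^ 2) + 1 / (2 * M) * (‖c n‖ ^ 2 / ((n : ℝ) + 1)) := by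
      intro n
      have hn : (0 : ℝ) < n + 1 := by positivity
      rw [norm_mul, ← sub_nonneg]
      have : M / 2 * (((n : ℝ) + 1) * ‖a n‖ ^ 2) + 1 / (2 * M) * (‖c n‖ ^ 2 / ((n : ℝ) + 1)) -
          ‖a n‖ * ‖c n‖ = (M * (n + 1) * ‖a n‖ - ‖c n‖) ^ 2 / (2 * M * (n + 1)) := by
        field_simp
        ring
      rw [this]
      positivity
    refine (norm_sum_le _ _).trans ((Finset.sum_le_sum fun n _ => hterm n).trans ?_)
    rw [Finset.sum_add_distrib, ← Finset.mul_sum, ← Finset.mul_sum]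
    have h1 := mul_le_mul_of_nonneg_left (ha N) (by positivity : 0 ≤ M / 2)
    have h2 := mul_le_mul_of_nonneg_left (hY N) (by positivity : 0 ≤ 1 / (2 * M))
    have h3 : 1 / (2 * M) * (M * X) = X / 2 := by field_simp
    linarith
  have hXle := le_of_tendsto hpair.tendsto_sum_nat.norm (Eventually.of_forall hfin)
  rw [Complex.norm_real, Real.norm_of_nonneg hX0] at hXle
  linarith

/-- A finite measure on the disk with bounded logarithmic potential is a Carleson measure. -/
lemma isCarlesonDirichlet_of_lintegral_log_le (μ : Measure ℂ) [IsFiniteMeasure μ] {M : ℝ}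
    (hM : 0 < M) (hpot : ∀ w ∈ Metric.ball (0:ℂ) 1,
      ∫⁻ z, ‖Complex.log (1 - z * starRingEnd ℂ w)‖ₑ ∂μ ≤ ENNReal.ofReal M) :
    IsCarlesonDirichlet μ := by
  refine ⟨2 * μ.real univ + 2 * M, fun f hf => ?_⟩
  obtain ⟨a, hfa, hda⟩ := exists_hasSum_coeff hf.1
  set D := (1 / Real.pi) * ∫ z in Metric.ball (0:ℂ) 1, ‖deriv f z‖ ^ 2 with hD
  have hD0 : 0 ≤ D := mul_nonneg (by positivity) (integral_nonneg fun _ => by positivity)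
  have haD : ∀ N, ∑ n ∈ Finset.range N, ((n : ℝ) + 1) * ‖a n‖ ^ 2 ≤ D :=
    sum_coeff_le_dirichlet hf hda
  have hcompact : ∀ R : ℝ, 0 ≤ R → R < 1 →
      ∫⁻ z in Metric.closedBall (0:ℂ) R, ENNReal.ofReal (‖f z - f 0‖ ^ 2) ∂μ ≤
        ENNReal.ofReal (M * D) := by
    intro R hR0 hR1
    have hsub : Metric.closedBall (0:ℂ) R ⊆ Metric.ball 0 1 := Metric.closedBall_subset_ball hR1
    have hgm : AEStronglyMeasurable (fun z => f z - f 0)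
        (μ.restrict (Metric.closedBall (0:ℂ) R)) :=
      ((hf.1.continuousOn.mono hsub).sub continuousOn_const).aestronglyMeasurable
        Metric.isClosed_closedBall.measurableSet
    obtain ⟨hint, hle⟩ := integral_norm_sq_le (μ.restrict (Metric.closedBall (0:ℂ) R)) hR0 hR1
      (by
        filter_upwards [ae_restrict_mem Metric.isClosed_closedBall.measurableSet] with z hz
        simpa using hz) hM
      (fun w hw => (setLIntegral_le_lintegral _ _).trans (hpot w hw)) hgm hfa haD
    rw [← ofReal_integral_eq_lintegral_ofReal hint (Eventually.of_forall fun _ => by positivity)]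
    exact ENNReal.ofReal_le_ofReal hle
  have hball : ∫⁻ z in Metric.ball (0:ℂ) 1, ENNReal.ofReal (‖f z - f 0‖ ^ 2) ∂μ ≤
      ENNReal.ofReal (M * D) := by
    set R : ℕ → ℝ := fun n => 1 - 1 / ((n : ℝ) + 1) with hR
    have hRmono : Monotone R := fun m n hmn => by
      simp only [hR]
      have := Nat.one_div_le_one_div (α := ℝ) hmn
      linarith
    have hUnion : Metric.ball (0:ℂ) 1 = ⋃ n, Metric.closedBall (0:ℂ) (R n) := by
      ext z
      simp only [mem_ball_zero_iff, mem_iUnion, mem_closedBall_zero_iff]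
      constructor
      · intro hz
        obtain ⟨n, hn⟩ := exists_nat_one_div_lt (sub_pos.2 hz)
        exact ⟨n, by simp only [hR]; linarith⟩
      · rintro ⟨n, hn⟩
        have : 0 < 1 / ((n : ℝ) + 1) := Nat.one_div_pos_of_nat
        simp only [hR] at hn
        linarith
    rw [hUnion, setLIntegral_iUnion_of_directed _
      (Monotone.directed_le fun m n hmn => Metric.closedBall_subset_closedBall (hRmono hmn))]
    refine iSup_le fun n => hcompact (R n) ?_ ?_
    · have : 1 / ((n : ℝ) + 1) ≤ 1 := by
        rw [div_le_one (by positivity)]; simp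
      simp only [hR]; linarith
    · have : 0 < 1 / ((n : ℝ) + 1) := Nat.one_div_pos_of_nat
      simp only [hR]; linarith
  calc ∫⁻ z in Metric.ball (0:ℂ) 1, ENNReal.ofReal (‖f z‖ ^ 2) ∂μ
      ≤ ∫⁻ z in Metric.ball (0:ℂ) 1, (ENNReal.ofReal (2 * ‖f 0‖ ^ 2) +
          2 * ENNReal.ofReal (‖f z - f 0‖ ^ 2)) ∂μ := by
        refine lintegral_mono fun z => ?_
        rw [show (2 : ENNReal) = ENNReal.ofReal 2 by simp, ← ENNReal.ofReal_mul zero_le_two,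
          ← ENNReal.ofReal_add (by positivity) (by positivity)]
        refine ENNReal.ofReal_le_ofReal ?_
        have h := norm_add_le (f 0) (f z - f 0)
        rw [add_sub_cancel] at h
        nlinarith [norm_nonneg (f z), sq_nonneg (‖f 0‖ - ‖f z - f 0‖)]
    _ = ENNReal.ofReal (2 * ‖f 0‖ ^ 2) * μ (Metric.ball (0:ℂ) 1) +
          2 * ∫⁻ z in Metric.ball (0:ℂ) 1, ENNReal.ofReal (‖f z - f 0‖ ^ 2) ∂μ := by
        rw [lintegral_add_left measurable_const, lintegral_const, Measure.restrict_apply_univ,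
          lintegral_const_mul' _ _ (by simp)]
    _ ≤ ENNReal.ofReal (2 * ‖f 0‖ ^ 2) * ENNReal.ofReal (μ.real univ) +
          2 * ENNReal.ofReal (M * D) := by
        gcongr
        rw [ofReal_measureReal]
        exact measure_mono (subset_univ _)
    _ = ENNReal.ofReal (2 * ‖f 0‖ ^ 2 * μ.real univ + 2 * (M * D)) := by
        rw [ENNReal.ofReal_add (by positivity) (by positivity),
          ENNReal.ofReal_mul (p := 2 * ‖f 0‖ ^ 2) (by positivity),
          ENNReal.ofReal_mul (q := M * D) zero_le_two, ENNReal.ofReal_ofNat]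
    _ ≤ _ := by
        refine ENNReal.ofReal_le_ofReal ?_
        rw [dirichletNormSq, ← hD]
        have h1 : 0 ≤ μ.real univ * D := by positivity
        have h2 : 0 ≤ M * ‖f 0‖ ^ 2 := by positivity
        nlinarith

/-- **Theorem 1 (one-box sufficient condition).** If `μ` is a finite Borel measure on the
unit disk satisfying `μ(S(I)) ≤ C φ(|I|)` for all small arcs `I`, where `φ` is increasing
and positive on `(0, 2π]` with `∫₀^{2π} φ(x)/x dx < ∞`, then `μ` is a Carleson measure
for the Dirichlet space. -/
theorem statement0 (μ : Measure ℂ) [IsFiniteMeasure μ]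
    (hμsupp : μ (Metric.ball (0:ℂ) 1)ᶜ = 0)
    (φ : ℝ → ℝ)
    (hφpos : ∀ x ∈ Set.Ioc (0:ℝ) (2 * Real.pi), 0 < φ x)
    (hφmono : MonotoneOn φ (Set.Ioc (0:ℝ) (2 * Real.pi)))
    (hφint : ∫⁻ x in Set.Ioc (0:ℝ) (2 * Real.pi), ENNReal.ofReal (φ x / x) < ⊤)
    (C ε : ℝ) (hC : 0 < C) (hε : 0 < ε) (hε' : ε ≤ 2 * Real.pi)
    (hbox : ∀ θ ℓ : ℝ, 0 < ℓ → ℓ < ε →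
      μ (carlesonBox θ ℓ) ≤ ENNReal.ofReal (C * φ ℓ)) :
    IsCarlesonDirichlet μ := by
  obtain ⟨M, hM, hpot⟩ := exists_lintegral_log_le μ hμsupp φ hφint C ε hC hε hε' hbox
  exact isCarlesonDirichlet_of_lintegral_log_le μ hM hpot

end
end

section
/- Let φ : (0, 2π] → (0, ∞) be a continuous increasing function such that x ↦ φ(x)/x is strictly decreasing and ∫₀^{2π} φ(x)/x dx = ∞. Then there exists a finite positive Borel measure μ on the open unit disk 𝔻 such that μ(S(I)) = O(φ(|I|)) as |I| → 0 (i.e., there exist C > 0 and ε > 0 with μ(S(I)) ≤ C·φ(|I|) for all arcs I with |I| < ε), but μ is not a Carleson measure for the Dirichlet space 𝒟. -/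
open MeasureTheory Metric Complex Filter Set

noncomputable section

/-- Left endpoints of the intervals of the `n`-th generation of the Cantor-type construction in
which generation `n` consists of intervals of length `l n`; the children of the interval with
index `i` have indices `2 * i` and `2 * i + 1`. -/
def cantorPoint (l : ℕ → ℝ) : ℕ → ℕ → ℝ
  | 0, i => i * l 0
  | n + 1, i => cantorPoint l n (i / 2) + (i % 2 : ℕ) * (l n - l (n + 1))

/-- The logarithmic size `log (l 0 / l J)`, where `J` is the last generation at which the points
with indices `i` and `i'` lie in the same interval. -/
def cantorLog (l : ℕ → ℝ) : ℕ → ℕ → ℕ → ℝ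
  | 0, _, _ => 0
  | n + 1, i, i' => cantorLog l n (i / 2) (i' / 2) +
      if i = i' then Real.log (l n / l (n + 1)) else 0

section Cantor

variable {l : ℕ → ℝ}

lemma cantorPoint_add_le_succ (h2 : ∀ n, 2 * l (n + 1) ≤ l n) (n i : ℕ) :
    cantorPoint l n i + l n ≤ cantorPoint l n (i + 1) := by
  induction n generalizing i with
  | zero => simp only [cantorPoint]; push_cast; linarith
  | succ n ih =>
    have h := h2 n
    rcases Nat.even_or_odd' i with ⟨k, rfl | rfl⟩
    · have e1 : 2 * k / 2 = k := by omega
      have e2 : (2 * k + 1) / 2 = k := by omega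
      have e3 : 2 * k % 2 = 0 := by omega
      have e4 : (2 * k + 1) % 2 = 1 := by omega
      simp only [cantorPoint, e1, e2, e3, e4]
      push_cast
      linarith
    · have e1 : (2 * k + 1) / 2 = k := by omega
      have e2 : (2 * k + 1 + 1) / 2 = k + 1 := by omega
      have e3 : (2 * k + 1) % 2 = 1 := by omega
      have e4 : (2 * k + 1 + 1) % 2 = 0 := by omega
      simp only [cantorPoint, e1, e2, e3, e4]
      push_cast
      linarith [ih k]

lemma cantorPoint_add_two_mul_le (hpos : ∀ n, 0 < l n) (h2 : ∀ n, 2 * l (n + 1) ≤ l n) (n : ℕ)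
    {p q : ℕ} (hpq : p + 2 ≤ q) : cantorPoint l n p + 2 * l n ≤ cantorPoint l n q := by
  have hmono : Monotone (cantorPoint l n) := monotone_nat_of_le_succ fun i => by
    linarith [cantorPoint_add_le_succ h2 n i, hpos n]
  linarith [hmono hpq, cantorPoint_add_le_succ h2 n p, cantorPoint_add_le_succ h2 n (p + 1)]

lemma cantorPoint_ancestor_le (h1 : Antitone l) (n k i : ℕ) :
    cantorPoint l n (i / 2 ^ k) ≤ cantorPoint l (n + k) i ∧
      cantorPoint l (n + k) i ≤ cantorPoint l n (i / 2 ^ k) + (l n - l (n + k)) := by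
  induction k generalizing i with
  | zero => simp
  | succ k ih =>
    obtain ⟨ha, hb⟩ := ih (i / 2)
    have hl := h1 (Nat.le_succ (n + k))
    rw [Nat.div_div_eq_div_mul, ← pow_succ'] at ha hb
    rw [← add_assoc]
    rcases Nat.mod_two_eq_zero_or_one i with h | h <;>
      simp only [cantorPoint, h] <;> push_cast <;> constructor <;>
      simp only [Nat.succ_eq_add_one] at hl <;> linarith

/-- Among the points of generation `n`, those that are pairwise closer than `l j` lie in at most
two intervals of generation `j ≤ n`. -/
lemma card_le_of_cantorPoint_close (hpos : ∀ n, 0 < l n) (h2 : ∀ n, 2 * l (n + 1) ≤ l n)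
    {j n : ℕ} (hjn : j ≤ n) (A : Finset ℕ)
    (hA : ∀ a ∈ A, ∀ b ∈ A, cantorPoint l n a - cantorPoint l n b < l j) :
    A.card ≤ 2 * 2 ^ (n - j) := by
  have h1 : Antitone l := antitone_nat_of_succ_le fun n => by linarith [h2 n, hpos (n + 1)]
  rcases A.eq_empty_or_nonempty with rfl | hne
  · simp
  obtain ⟨m, hmA, hm⟩ := A.exists_min_image (fun a => a / 2 ^ (n - j)) hne
  have hsub : A ⊆ Finset.Ico (m / 2 ^ (n - j) * 2 ^ (n - j))
      (m / 2 ^ (n - j) * 2 ^ (n - j) + 2 * 2 ^ (n - j)) := by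
    intro a ha
    have hma := hm a ha
    have hlt : a / 2 ^ (n - j) < m / 2 ^ (n - j) + 2 := by
      by_contra! hcon
      have hs := cantorPoint_add_two_mul_le hpos h2 j hcon
      have hd := hA a ha m hmA
      obtain ⟨k, rfl⟩ := Nat.exists_eq_add_of_le hjn
      rw [Nat.add_sub_cancel_left] at hs
      linarith [(cantorPoint_ancestor_le h1 j k a).1, (cantorPoint_ancestor_le h1 j k m).2,
        hpos (j + k)]
    have hp : 0 < 2 ^ (n - j) := by positivity
    rw [Finset.mem_Ico]
    constructor
    · exact (Nat.mul_le_mul_right _ hma).trans (Nat.div_mul_le_self _ _)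
    · rw [← add_mul]
      exact (Nat.div_lt_iff_lt_mul hp).1 hlt
  simpa using Finset.card_le_card hsub

lemma cantorPoint_mem_Icc (hpos : ∀ n, 0 < l n) (h2 : ∀ n, 2 * l (n + 1) ≤ l n) {n i : ℕ}
    (hi : i < 2 ^ n) : cantorPoint l n i ∈ Set.Icc 0 (l 0) := by
  have h1 : Antitone l := antitone_nat_of_succ_le fun n => by linarith [h2 n, hpos (n + 1)]
  have h := cantorPoint_ancestor_le h1 0 n i
  rw [Nat.div_eq_of_lt hi, zero_add] at h
  simp only [cantorPoint, Nat.cast_zero, zero_mul, zero_add] at h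
  exact ⟨h.1, by linarith [hpos n]⟩

lemma exp_neg_cantorLog_self (hpos : ∀ n, 0 < l n) (n i : ℕ) :
    l 0 * Real.exp (-cantorLog l n i i) = l n := by
  induction n generalizing i with
  | zero => simp [cantorLog]
  | succ n ih =>
    have hn := (hpos n).ne'
    have hn' := (hpos (n + 1)).ne'
    rw [cantorLog, if_pos rfl, neg_add, Real.exp_add, ← mul_assoc, ih, Real.exp_neg,
      Real.exp_log (div_pos (hpos _) (hpos _))]
    field_simp

lemma abs_cantorPoint_sub_le (hpos : ∀ n, 0 < l n) (h1 : Antitone l) (n : ℕ) {i i' : ℕ}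
    (hi : i < 2 ^ n) (hi' : i' < 2 ^ n) :
    |cantorPoint l n i - cantorPoint l n i'| + l n ≤ l 0 * Real.exp (-cantorLog l n i i') := by
  by_cases hii : i = i'
  · subst hii
    rw [exp_neg_cantorLog_self hpos]
    simp
  induction n generalizing i i' with
  | zero => omega
  | succ n ih =>
    rw [cantorLog, if_neg hii, add_zero]
    have hl : l (n + 1) ≤ l n := h1 (Nat.le_succ n)
    have hstep : |cantorPoint l n (i / 2) - cantorPoint l n (i' / 2)| + l n ≤
        l 0 * Real.exp (-cantorLog l n (i / 2) (i' / 2)) := by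
      by_cases hh : i / 2 = i' / 2
      · rw [hh, exp_neg_cantorLog_self hpos]
        simp
      · exact ih (by omega) (by omega) hh
    refine le_trans ?_ hstep
    have hkey : |((i % 2 : ℕ) : ℝ) - ((i' % 2 : ℕ) : ℝ)| ≤ 1 := by
      rcases Nat.mod_two_eq_zero_or_one i with h | h <;>
        rcases Nat.mod_two_eq_zero_or_one i' with h' | h' <;> simp [h, h']
    have hsplit : cantorPoint l (n + 1) i - cantorPoint l (n + 1) i' =
        (cantorPoint l n (i / 2) - cantorPoint l n (i' / 2)) +
          (((i % 2 : ℕ) : ℝ) - ((i' % 2 : ℕ) : ℝ)) * (l n - l (n + 1)) := by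
      simp only [cantorPoint]; ring
    have habs := abs_add_le (cantorPoint l n (i / 2) - cantorPoint l n (i' / 2))
      ((((i % 2 : ℕ) : ℝ) - ((i' % 2 : ℕ) : ℝ)) * (l n - l (n + 1)))
    rw [← hsplit, abs_mul, abs_of_nonneg (sub_nonneg.2 hl)] at habs
    nlinarith [mul_le_mul_of_nonneg_right hkey (sub_nonneg.2 hl)]

lemma sum_range_two_mul_div_two (N : ℕ) (g : ℕ → ℝ) :
    ∑ i ∈ Finset.range (2 * N), g (i / 2) = 2 * ∑ i ∈ Finset.range N, g i := by
  induction N with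
  | zero => simp
  | succ N ih =>
    rw [mul_add, mul_one, Finset.sum_range_succ, Finset.sum_range_succ, ih, Finset.sum_range_succ,
      show (2 * N + 1) / 2 = N by omega, show 2 * N / 2 = N by omega]
    ring

lemma sum_cantorLog (n : ℕ) :
    ∑ i ∈ Finset.range (2 ^ n), ∑ i' ∈ Finset.range (2 ^ n), cantorLog l n i i' =
      4 ^ n * ∑ j ∈ Finset.range n, (1 / 2) ^ (j + 1) * Real.log (l j / l (j + 1)) := by
  induction n with
  | zero => simp [cantorLog]
  | succ n ih =>
    simp only [cantorLog, Finset.sum_add_distrib, Finset.sum_ite_eq]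
    rw [Finset.sum_ite_mem, Finset.inter_self, Finset.sum_const, Finset.card_range, nsmul_eq_mul,
      Finset.sum_range_succ]
    have h : ∀ i : ℕ, ∑ i' ∈ Finset.range (2 ^ (n + 1)), cantorLog l n (i / 2) (i' / 2) =
        2 * ∑ i' ∈ Finset.range (2 ^ n), cantorLog l n (i / 2) i' := fun i => by
      rw [pow_succ', sum_range_two_mul_div_two _ (fun i' => cantorLog l n (i / 2) i')]
    simp only [h]
    rw [← Finset.mul_sum, pow_succ', sum_range_two_mul_div_two _
      (fun i => ∑ i' ∈ Finset.range (2 ^ n), cantorLog l n i i'), ih]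
    have e : (4 : ℝ) ^ n = 2 ^ n * 2 ^ n := by rw [← mul_pow]; norm_num
    push_cast
    have e' : (1 / 2 : ℝ) ^ n * 2 ^ n = 1 := by rw [← mul_pow]; norm_num
    rw [pow_succ, pow_succ, e]
    linear_combination (-2 * 2 ^ n * Real.log (l n / l (n + 1))) * e'

end Cantor

lemma integral_exp_int_mul_I (n : ℤ) :
    ∫ t in Ioo (-Real.pi) Real.pi, Complex.exp (n * Complex.I * t) =
      if n = 0 then ((2 * Real.pi : ℝ) : ℂ) else 0 := by
  rw [← integral_Ioc_eq_integral_Ioo,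
    ← intervalIntegral.integral_of_le (by linarith [Real.pi_pos])]
  split_ifs with h
  · subst h
    simp only [Int.cast_zero, zero_mul, Complex.exp_zero, intervalIntegral.integral_const]
    simp [two_mul]
  · have hc : (n : ℂ) * Complex.I ≠ 0 := by simp [h]
    rw [integral_exp_mul_complex hc, div_eq_zero_iff]
    left
    rw [sub_eq_zero, Complex.exp_eq_exp_iff_exists_int]
    exact ⟨n, by push_cast; ring⟩

lemma integral_ball_pow_mul_conj_pow (j k : ℕ) :
    ∫ z in ball (0 : ℂ) 1, z ^ j * (starRingEnd ℂ) z ^ k =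
      if j = k then ((Real.pi / (k + 1) : ℝ) : ℂ) else 0 := by
  have hpol : ∀ p ∈ polarCoord.target,
      p.1 • (ball 0 1).indicator (fun z : ℂ => z ^ j * (starRingEnd ℂ) z ^ k)
          (Complex.polarCoord.symm p) =
        (Ioo 0 1).indicator (fun r : ℝ => ((r ^ (j + k + 1) : ℝ) : ℂ)) p.1 *
          Complex.exp (((j : ℤ) - (k : ℤ) : ℤ) * Complex.I * p.2) := by
    rintro ⟨r, t⟩ hp
    have hr : 0 < r := (Set.mem_prod.1 hp).1
    have hz : Complex.polarCoord.symm (r, t) = r * Complex.exp (t * Complex.I) := by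
      rw [Complex.polarCoord_symm_apply, Complex.exp_mul_I]
      push_cast
      rfl
    have hmem : Complex.polarCoord.symm (r, t) ∈ ball (0 : ℂ) 1 ↔ r ∈ Ioo (0 : ℝ) 1 := by
      rw [hz, mem_ball_zero_iff, norm_mul, Complex.norm_exp_ofReal_mul_I, mul_one,
        Complex.norm_real, Real.norm_of_nonneg hr.le]
      simp [hr]
    by_cases h1 : r ∈ Ioo (0 : ℝ) 1
    · rw [Set.indicator_of_mem (hmem.2 h1), Set.indicator_of_mem h1, hz, map_mul,
        ← Complex.exp_conj, map_mul, Complex.conj_ofReal, Complex.conj_ofReal, Complex.conj_I,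
        mul_pow, mul_pow, ← Complex.exp_nat_mul, ← Complex.exp_nat_mul, Complex.real_smul]
      have e : Complex.exp (((j : ℤ) - (k : ℤ) : ℤ) * Complex.I * t) =
          Complex.exp (j * (t * Complex.I)) * Complex.exp (k * (t * -Complex.I)) := by
        rw [← Complex.exp_add]
        congr 1
        push_cast
        ring
      rw [e]
      push_cast
      ring
    · rw [Set.indicator_of_notMem (fun h => h1 (hmem.1 h)), Set.indicator_of_notMem h1]
      simp
  rw [← integral_indicator measurableSet_ball, ← Complex.integral_comp_polarCoord_symm,
    setIntegral_congr_fun polarCoord.open_target.measurableSet hpol, polarCoord_target,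
    Measure.volume_eq_prod,
    setIntegral_prod_mul (fun r => (Ioo 0 1).indicator (fun r : ℝ => ((r ^ (j + k + 1) : ℝ) : ℂ)) r)
      (fun t : ℝ => Complex.exp (((j : ℤ) - (k : ℤ) : ℤ) * Complex.I * t)),
    setIntegral_indicator measurableSet_Ioo, integral_exp_int_mul_I,
    Set.inter_eq_right.2 Ioo_subset_Ioi_self, ← integral_Ioc_eq_integral_Ioo,
    ← intervalIntegral.integral_of_le zero_le_one, intervalIntegral.integral_ofReal, integral_pow]
  by_cases h : j = k
  · subst h
    simp only [sub_self, if_true]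
    rw [← Complex.ofReal_mul]
    congr 1
    push_cast
    have : (j : ℝ) + 1 ≠ 0 := by positivity
    have h' : (j : ℝ) + j + 1 + 1 ≠ 0 := by positivity
    field_simp
    ring
  · have h' : ((j : ℤ) - (k : ℤ) : ℤ) ≠ 0 := by omega
    simp [h, h']

lemma integral_ball_norm_sq_sum_pow (a : ℕ → ℂ) (K : ℕ) :
    ∫ z in ball (0 : ℂ) 1, ‖∑ k ∈ Finset.range K, a k * z ^ k‖ ^ 2 =
      Real.pi * ∑ k ∈ Finset.range K, ‖a k‖ ^ 2 / (k + 1) := by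
  have hint : ∀ c : ℂ, ∀ j k : ℕ, Integrable (fun z : ℂ => c * (z ^ j * (starRingEnd ℂ) z ^ k))
      (volume.restrict (ball (0 : ℂ) 1)) := fun c j k =>
    ((Continuous.continuousOn (by fun_prop)).integrableOn_compact
      (isCompact_closedBall 0 1)).mono_set ball_subset_closedBall
  rw [← Complex.ofReal_inj, ← integral_complex_ofReal]
  have hexp : ∀ z : ℂ, ((‖∑ k ∈ Finset.range K, a k * z ^ k‖ ^ 2 : ℝ) : ℂ) =
      ∑ j ∈ Finset.range K, ∑ k ∈ Finset.range K,
        a j * (starRingEnd ℂ) (a k) * (z ^ j * (starRingEnd ℂ) z ^ k) := by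
    intro z
    rw [Complex.ofReal_pow, ← Complex.mul_conj', map_sum, Finset.sum_mul_sum]
    refine Finset.sum_congr rfl fun j _ => Finset.sum_congr rfl fun k _ => ?_
    rw [map_mul, map_pow]
    ring
  simp only [hexp]
  rw [integral_finsetSum _ fun j _ => integrable_finsetSum _ fun k _ => hint _ j k]
  push_cast
  rw [Finset.mul_sum]
  refine Finset.sum_congr rfl fun j hj => ?_
  rw [integral_finsetSum _ fun k _ => hint _ j k]
  simp only [integral_const_mul, integral_ball_pow_mul_conj_pow, mul_ite, mul_zero,
    Finset.sum_ite_eq, if_pos hj, Complex.mul_conj']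
  push_cast
  ring

section Moments

/-- The normalised moment `N⁻¹ ∑ wᵢ ^ k` of the uniform distribution on `w 0, …, w (N - 1)`. -/
def moment (w : ℕ → ℂ) (N k : ℕ) : ℂ := (N : ℂ)⁻¹ * ∑ i ∈ Finset.range N, w i ^ k

/-- Partial sums of the logarithmic energy of the uniform distribution on `w 0, …, w (N - 1)`. -/
def partialEnergy (w : ℕ → ℂ) (N K : ℕ) : ℝ :=
  ∑ k ∈ Finset.range K, ‖moment w N (k + 1)‖ ^ 2 / (k + 1)

/-- Truncated logarithmic potential of the uniform distribution on `w 0, …, w (N - 1)`. -/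
def truncPotential (w : ℕ → ℂ) (N K : ℕ) (z : ℂ) : ℂ :=
  ∑ k ∈ Finset.range K, (starRingEnd ℂ) (moment w N (k + 1)) / (k + 1) * z ^ (k + 1)

variable (w : ℕ → ℂ) (N K : ℕ)

lemma hasDerivAt_truncPotential (z : ℂ) : HasDerivAt (truncPotential w N K)
    (∑ k ∈ Finset.range K, (starRingEnd ℂ) (moment w N (k + 1)) * z ^ k) z := by
  unfold truncPotential
  refine HasDerivAt.fun_sum fun k _ => ?_
  have h := (hasDerivAt_pow (k + 1) z).const_mul
    ((starRingEnd ℂ) (moment w N (k + 1)) / ((k : ℂ) + 1))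
  have hk : (k : ℂ) + 1 ≠ 0 := Nat.cast_add_one_ne_zero k
  refine h.congr_deriv ?_
  rw [Nat.add_sub_cancel]
  push_cast
  field_simp

lemma deriv_truncPotential : deriv (truncPotential w N K) =
    fun z => ∑ k ∈ Finset.range K, (starRingEnd ℂ) (moment w N (k + 1)) * z ^ k :=
  funext fun z => (hasDerivAt_truncPotential w N K z).deriv

lemma inDirichlet_truncPotential : InDirichlet (truncPotential w N K) := by
  refine ⟨fun z _ => (hasDerivAt_truncPotential w N K z).differentiableAt.differentiableWithinAt,
    ?_⟩
  rw [deriv_truncPotential]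
  exact ((Continuous.continuousOn (by fun_prop)).integrableOn_compact
      (isCompact_closedBall 0 1)).mono_set ball_subset_closedBall

lemma dirichletNormSq_truncPotential :
    dirichletNormSq (truncPotential w N K) = partialEnergy w N K := by
  rw [dirichletNormSq, deriv_truncPotential, integral_ball_norm_sq_sum_pow, ← mul_assoc,
    one_div, inv_mul_cancel₀ Real.pi_ne_zero, one_mul]
  simp [truncPotential, partialEnergy]

lemma average_truncPotential :
    (N : ℂ)⁻¹ * ∑ i ∈ Finset.range N, truncPotential w N K (w i) = (partialEnergy w N K : ℂ) := by
  unfold truncPotential partialEnergy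
  rw [Finset.sum_comm, Finset.mul_sum]
  push_cast
  refine Finset.sum_congr rfl fun k _ => ?_
  rw [← Finset.mul_sum, ← Complex.conj_mul']
  conv_rhs => rw [moment]
  rw [moment]
  ring

lemma partialEnergy_sq_le : partialEnergy w N K ^ 2 ≤
    (N : ℝ)⁻¹ * ∑ i ∈ Finset.range N, ‖truncPotential w N K (w i)‖ ^ 2 := by
  rcases Nat.eq_zero_or_pos N with rfl | hN
  · simp [partialEnergy, moment]
  have h := congrArg norm (average_truncPotential w N K)
  rw [Complex.norm_real, Real.norm_eq_abs, norm_mul, norm_inv, Complex.norm_natCast] at h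
  rw [← sq_abs, ← h, mul_pow]
  have h1 : ‖∑ i ∈ Finset.range N, truncPotential w N K (w i)‖ ^ 2 ≤
      N * ∑ i ∈ Finset.range N, ‖truncPotential w N K (w i)‖ ^ 2 := by
    refine (pow_le_pow_left₀ (norm_nonneg _) (norm_sum_le _ _) 2).trans ?_
    simpa using sq_sum_le_card_mul_sum_sq (s := Finset.range N)
      (f := fun i => ‖truncPotential w N K (w i)‖)
  have hN' : (0 : ℝ) < N := by exact_mod_cast hN
  calc ((N : ℝ)⁻¹) ^ 2 * ‖∑ i ∈ Finset.range N, truncPotential w N K (w i)‖ ^ 2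
      ≤ ((N : ℝ)⁻¹) ^ 2 * (N * ∑ i ∈ Finset.range N, ‖truncPotential w N K (w i)‖ ^ 2) := by gcongr
    _ = _ := by field_simp

lemma partialEnergy_nonneg : 0 ≤ partialEnergy w N K :=
  Finset.sum_nonneg fun k _ => by positivity

lemma hasSum_energy {w : ℕ → ℂ} (hw : ∀ i < N, ‖w i‖ < 1) :
    HasSum (fun k : ℕ => ‖moment w N (k + 1)‖ ^ 2 / ((k : ℝ) + 1))
      ((N : ℝ)⁻¹ ^ 2 * ∑ i ∈ Finset.range N, ∑ i' ∈ Finset.range N,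
        -Real.log ‖1 - w i * (starRingEnd ℂ) (w i')‖) := by
  have hterm : ∀ i ∈ Finset.range N, ∀ i' ∈ Finset.range N,
      HasSum (fun k : ℕ => ((w i * (starRingEnd ℂ) (w i')) ^ (k + 1) / ((k + 1 : ℕ) : ℂ)).re)
        (-Real.log ‖1 - w i * (starRingEnd ℂ) (w i')‖) := by
    intro i hi i' hi'
    have hlt : ‖w i * (starRingEnd ℂ) (w i')‖ < 1 := by
      rw [norm_mul, RCLike.norm_conj]
      exact mul_lt_one_of_nonneg_of_lt_one_left (norm_nonneg _) (hw i (Finset.mem_range.1 hi))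
        (hw i' (Finset.mem_range.1 hi')).le
    have h := (hasSum_nat_add_iff' 1).2 (Complex.hasSum_taylorSeries_neg_log hlt)
    simpa [Complex.log_re] using Complex.hasSum_re h
  have hsum := (hasSum_sum fun i hi => hasSum_sum fun i' hi' => hterm i hi i' hi').mul_left
    ((N : ℝ)⁻¹ ^ 2)
  refine hsum.congr_fun fun k => ?_
  have hm : ((‖moment w N (k + 1)‖ ^ 2 / ((k : ℝ) + 1) : ℝ) : ℂ) =
      (((N : ℝ)⁻¹ ^ 2 : ℝ) : ℂ) * ∑ i ∈ Finset.range N, ∑ i' ∈ Finset.range N,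
        (w i * (starRingEnd ℂ) (w i')) ^ (k + 1) / ((k + 1 : ℕ) : ℂ) := by
    push_cast
    rw [← Complex.mul_conj', moment, map_mul, map_sum, map_inv₀, Complex.conj_natCast]
    simp only [mul_pow, ← Finset.sum_div, map_pow]
    rw [← Finset.sum_mul_sum]
    ring
  have hre := congrArg Complex.re hm
  rw [Complex.ofReal_re, Complex.re_ofReal_mul] at hre
  simpa only [Complex.re_sum] using hre

lemma le_of_partialEnergy_le {w : ℕ → ℂ} {N : ℕ} (hw : ∀ i < N, ‖w i‖ < 1) {M : ℝ}
    (hM : ∀ K, partialEnergy w N K ≤ M) :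
    (N : ℝ)⁻¹ ^ 2 * ∑ i ∈ Finset.range N, ∑ i' ∈ Finset.range N,
        -Real.log ‖1 - w i * (starRingEnd ℂ) (w i')‖ ≤ M :=
  le_of_tendsto' (hasSum_energy N hw).tendsto_sum_nat hM

end Moments

/-- Scales `l n` with `(1 / 2) ^ n ≲ φ (l n)` for which the divergence of `∫ φ x / x` becomes the
divergence of `∑ 2⁻ʲ log (l j / l (j + 1))`. -/
lemma exists_scales (φ : ℝ → ℝ)
    (hφcont : ContinuousOn φ (Set.Ioc (0 : ℝ) (2 * Real.pi)))
    (hφpos : ∀ x ∈ Set.Ioc (0 : ℝ) (2 * Real.pi), 0 < φ x)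
    (hφmono : MonotoneOn φ (Set.Ioc (0 : ℝ) (2 * Real.pi)))
    (hφratio : StrictAntiOn (fun x => φ x / x) (Set.Ioc (0 : ℝ) (2 * Real.pi)))
    (hφint : ∫⁻ x in Set.Ioc (0 : ℝ) (2 * Real.pi), ENNReal.ofReal (φ x / x) = ⊤) :
    ∃ (l : ℕ → ℝ) (C : ℝ), 0 < C ∧ (∀ n, 0 < l n) ∧ (∀ n, 2 * l (n + 1) ≤ l n) ∧ l 0 ≤ 1 / 2 ∧
      (∀ n, (1 / 2) ^ n ≤ C * φ (l n)) ∧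
      ∀ M, ∃ n, M ≤ ∑ j ∈ Finset.range n, (1 / 2) ^ (j + 1) * Real.log (l j / l (j + 1)) := by
  have hpi := Real.pi_gt_three
  by_cases hlow : ∃ c > 0, ∀ x ∈ Set.Ioc (0 : ℝ) (2 * Real.pi), c ≤ φ x
  · obtain ⟨c, hc, hcφ⟩ := hlow
    have hmem : ∀ n : ℕ, Real.exp (-4 ^ n) ≤ 1 / 2 := fun n => by
      have h4 : (1 : ℝ) ≤ 4 ^ n := one_le_pow₀ (by norm_num)
      have h1 : Real.exp (-4 ^ n) ≤ Real.exp (-1) := Real.exp_le_exp.2 (by linarith)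
      linarith [Real.exp_neg_one_lt_half]
    refine ⟨fun n => Real.exp (-4 ^ n), c⁻¹, inv_pos.2 hc, fun n => Real.exp_pos _, fun n => ?_,
      hmem 0, fun n => ?_, fun M => ?_⟩
    · have h4 : (1 : ℝ) ≤ 4 ^ n := one_le_pow₀ (by norm_num)
      have he : Real.exp (-4 ^ (n + 1)) = Real.exp (-(3 * 4 ^ n)) * Real.exp (-4 ^ n) := by
        rw [← Real.exp_add]; ring_nf
      have h1 : Real.exp (-(3 * 4 ^ n)) ≤ Real.exp (-1) := Real.exp_le_exp.2 (by linarith)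
      simp only [he]
      nlinarith [Real.exp_neg_one_lt_half, Real.exp_pos (-(4 : ℝ) ^ n)]
    · have h1 : ((1 : ℝ) / 2) ^ n ≤ 1 := pow_le_one₀ (by norm_num) (by norm_num)
      have h2 := hcφ (Real.exp (-4 ^ n)) ⟨Real.exp_pos _, by linarith [hmem n]⟩
      calc ((1 : ℝ) / 2) ^ n ≤ c⁻¹ * c := by rwa [inv_mul_cancel₀ hc.ne']
        _ ≤ _ := by gcongr
    · obtain ⟨n, hn⟩ := exists_nat_ge M
      refine ⟨n, hn.trans ?_⟩
      calc (n : ℝ) = ∑ j ∈ Finset.range n, 1 := by simp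
        _ ≤ _ := Finset.sum_le_sum fun j _ => ?_
      rw [← Real.exp_sub, Real.log_exp]
      have h2 : (1 : ℝ) ≤ 2 ^ j := one_le_pow₀ (by norm_num)
      have e : ((1 : ℝ) / 2) ^ (j + 1) * (-4 ^ j - -4 ^ (j + 1)) = 3 / 2 * 2 ^ j := by
        have : (4 : ℝ) ^ j = 2 ^ j * 2 ^ j := by rw [← mul_pow]; norm_num
        rw [pow_succ (4 : ℝ), this, one_div, inv_pow]
        field_simp
        ring
      rw [e]
      linarith
  · push Not at hlow
    have hmem0 : (1 / 2 : ℝ) ∈ Set.Ioc (0 : ℝ) (2 * Real.pi) := ⟨by norm_num, by linarith⟩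
    have hc := hφpos _ hmem0
    have hex : ∀ n : ℕ, ∃ x ∈ Set.Ioc (0 : ℝ) (1 / 2), φ x = φ (1 / 2) * (1 / 2) ^ n := by
      intro n
      obtain ⟨y, hy, hyφ⟩ := hlow (φ (1 / 2) * (1 / 2) ^ n) (by positivity)
      have hle : φ (1 / 2) * (1 / 2) ^ n ≤ φ (1 / 2) :=
        mul_le_of_le_one_right hc.le (pow_le_one₀ (by norm_num) (by norm_num))
      have hy2 : y ≤ 1 / 2 := by
        by_contra! hcon
        linarith [hφmono hmem0 hy hcon.le]
      obtain ⟨x, hx, hxφ⟩ := intermediate_value_Icc hy2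
        (hφcont.mono fun t ht => ⟨hy.1.trans_le ht.1, ht.2.trans hmem0.2⟩) ⟨hyφ.le, hle⟩
      exact ⟨x, ⟨hy.1.trans_le hx.1, hx.2⟩, hxφ⟩
    choose l hl hlφ using hex
    have hlmem : ∀ n, l n ∈ Set.Ioc (0 : ℝ) (2 * Real.pi) := fun n =>
      ⟨(hl n).1, (hl n).2.trans hmem0.2⟩
    have hhalf : ∀ n, 2 * l (n + 1) ≤ l n := by
      intro n
      by_contra! hcon
      have h0 := (hl (n + 1)).1
      have hm : 2 * l (n + 1) ∈ Set.Ioc (0 : ℝ) (2 * Real.pi) :=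
        ⟨by linarith, by linarith [(hl (n + 1)).2]⟩
      have hr := hφratio (hlmem (n + 1)) hm (by linarith)
      have hmn := hφmono (hlmem n) hm hcon.le
      simp only at hr
      rw [div_lt_div_iff₀ (by linarith) h0] at hr
      have h2 : φ (l n) = 2 * φ (l (n + 1)) := by rw [hlφ, hlφ, pow_succ]; ring
      nlinarith
    have hanti : Antitone l := antitone_nat_of_succ_le fun n => by linarith [hhalf n, (hl (n + 1)).1]
    have hlim : Tendsto l atTop (nhds 0) := by
      have hb : ∀ n, l n ≤ (1 / 2) ^ n := fun n => by
        induction n with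
        | zero => simpa using (hl 0).2.trans (by norm_num)
        | succ n ih => rw [pow_succ]; linarith [hhalf n]
      exact squeeze_zero (fun n => (hl n).1.le) hb
        (tendsto_pow_atTop_nhds_zero_of_lt_one (by norm_num) (by norm_num))
    refine ⟨l, (φ (1 / 2))⁻¹, inv_pos.2 hc, fun n => (hl n).1, hhalf, (hl 0).2, fun n => ?_, ?_⟩
    · rw [hlφ, inv_mul_cancel_left₀ hc.ne']
    by_contra! hcon
    obtain ⟨M, hM⟩ := hcon
    have hlog : ∀ j, 0 ≤ Real.log (l j / l (j + 1)) := fun j =>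
      Real.log_nonneg ((one_le_div (hl (j + 1)).1).2 (hanti (Nat.le_succ j)))
    have hint_le : ∀ (a b : ℝ), 0 < a → a ≤ b → b ≤ 2 * Real.pi →
        ∫⁻ x in Set.Ioc a b, ENNReal.ofReal (φ x / x) ≤
          ENNReal.ofReal (φ b * Real.log (b / a)) := by
      intro a b ha hab hb
      have hint : IntegrableOn (fun x : ℝ => φ b * x⁻¹) (Set.Ioc a b) := by
        refine IntegrableOn.mono_set ?_ Ioc_subset_Icc_self
        exact (continuousOn_const.mul (continuousOn_id.inv₀ fun x hx =>
          (ha.trans_le hx.1).ne')).integrableOn_Icc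
      calc ∫⁻ x in Set.Ioc a b, ENNReal.ofReal (φ x / x)
          ≤ ∫⁻ x in Set.Ioc a b, ENNReal.ofReal (φ b * x⁻¹) := by
            refine setLIntegral_mono' measurableSet_Ioc fun x hx => ENNReal.ofReal_le_ofReal ?_
            have hx0 := ha.trans hx.1
            rw [div_eq_mul_inv]
            exact mul_le_mul_of_nonneg_right (hφmono ⟨hx0, hx.2.trans hb⟩ ⟨ha.trans_le hab, hb⟩ hx.2)
              (inv_nonneg.2 hx0.le)
        _ = ENNReal.ofReal (φ b * Real.log (b / a)) := by
            rw [← ofReal_integral_eq_lintegral_ofReal hint, ← intervalIntegral.integral_of_le hab,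
              intervalIntegral.integral_const_mul, integral_inv_of_pos ha (ha.trans_le hab)]
            refine ae_restrict_of_forall_mem measurableSet_Ioc fun x hx => ?_
            exact mul_nonneg (hφpos b ⟨ha.trans_le hab, hb⟩).le (inv_nonneg.2 (ha.trans hx.1).le)
    have hcover : Set.Ioc (0 : ℝ) (2 * Real.pi) ⊆
        (⋃ j, Set.Ioc (l (j + 1)) (l j)) ∪ Set.Ioc (l 0) (2 * Real.pi) := by
      intro x hx
      by_cases hx0 : l 0 < x
      · exact Or.inr ⟨hx0, hx.2⟩
      left
      have hev : ∃ n, l n < x := (hlim.eventually (gt_mem_nhds hx.1)).exists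
      classical
      have hspec := Nat.find_spec hev
      have hmin := fun m => Nat.find_min hev (m := m)
      obtain ⟨k, hk⟩ : ∃ k, Nat.find hev = k + 1 :=
        Nat.exists_eq_succ_of_ne_zero fun h0 => hx0 (h0 ▸ hspec)
      rw [hk] at hspec hmin
      exact Set.mem_iUnion.2 ⟨k, hspec, not_lt.1 (hmin k (Nat.lt_succ_self k))⟩
    have hfin : ∑' j, ENNReal.ofReal (φ (l j) * Real.log (l j / l (j + 1))) ≤
        ENNReal.ofReal (2 * φ (1 / 2) * M) := by
      refine ENNReal.tsum_le_of_sum_range_le fun n => ?_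
      rw [← ENNReal.ofReal_sum_of_nonneg fun j _ => mul_nonneg (hφpos _ (hlmem j)).le (hlog j)]
      refine ENNReal.ofReal_le_ofReal ?_
      calc _ = 2 * φ (1 / 2) *
            ∑ j ∈ Finset.range n, (1 / 2) ^ (j + 1) * Real.log (l j / l (j + 1)) := by
            rw [Finset.mul_sum]
            refine Finset.sum_congr rfl fun j _ => ?_
            rw [hlφ, pow_succ]
            ring
        _ ≤ _ := mul_le_mul_of_nonneg_left (hM n).le (by linarith)
    have htop : (⊤ : ENNReal) ≤ ENNReal.ofReal (2 * φ (1 / 2) * M) +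
        ENNReal.ofReal (φ (2 * Real.pi) * Real.log (2 * Real.pi / l 0)) := by
      rw [← hφint]
      refine (lintegral_mono_set hcover).trans ((lintegral_union_le _ _ _).trans (add_le_add ?_ ?_))
      · exact (lintegral_iUnion_le _ _).trans ((ENNReal.tsum_le_tsum fun j =>
          hint_le _ _ (hl (j + 1)).1 (hanti (Nat.le_succ j)) (hlmem j).2).trans hfin)
      · exact hint_le _ _ (hl 0).1 (hlmem 0).2 le_rfl
    exact absurd htop (by simp)

section CantorMeasure

/-- The generation-`n` points, lifted to the circle of radius `1 - l n`. -/
def diskPoint (l : ℕ → ℝ) (n i : ℕ) : ℂ :=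
  ((1 - l n : ℝ) : ℂ) * Complex.exp (cantorPoint l n i * Complex.I)

/-- The uniform probability measure on the `2 ^ n` points of generation `n`. -/
def cantorMeasure (l : ℕ → ℝ) (n : ℕ) : Measure ℂ :=
  ∑ i ∈ Finset.range (2 ^ n), (2⁻¹ : ENNReal) ^ n • Measure.dirac (diskPoint l n i)

variable {l : ℕ → ℝ}

lemma norm_diskPoint {n : ℕ} (h1 : l n ≤ 1) (i : ℕ) : ‖diskPoint l n i‖ = 1 - l n := by
  rw [diskPoint, norm_mul, Complex.norm_exp_ofReal_mul_I, mul_one, Complex.norm_real,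
    Real.norm_of_nonneg (by linarith)]

lemma cantorMeasure_apply (n : ℕ) (s : Set ℂ) [DecidablePred fun i => diskPoint l n i ∈ s] :
    cantorMeasure l n s =
      (2⁻¹ : ENNReal) ^ n * ((Finset.range (2 ^ n)).filter fun i => diskPoint l n i ∈ s).card := by
  simp only [cantorMeasure, Measure.coe_finsetSum, Finset.sum_apply, Measure.smul_apply,
    Measure.dirac_apply, smul_eq_mul, ← Finset.mul_sum, Set.indicator_apply, Pi.one_apply,
    Finset.sum_boole]

lemma lintegral_cantorMeasure (n : ℕ) (g : ℂ → ENNReal) :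
    ∫⁻ z, g z ∂(cantorMeasure l n) =
      (2⁻¹ : ENNReal) ^ n * ∑ i ∈ Finset.range (2 ^ n), g (diskPoint l n i) := by
  simp only [cantorMeasure, lintegral_finsetSum_measure, lintegral_smul_measure, lintegral_dirac,
    smul_eq_mul, Finset.mul_sum]

lemma cantorMeasure_compl_ball {n : ℕ} (h0 : 0 < l n) (h1 : l n ≤ 1) :
    cantorMeasure l n (ball (0 : ℂ) 1)ᶜ = 0 := by
  classical
  rw [cantorMeasure_apply, Finset.filter_false_of_mem]
  · simp
  · intro i _
    rw [Set.notMem_compl_iff, mem_ball_zero_iff, norm_diskPoint h1]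
    linarith

lemma cantorMeasure_univ (n : ℕ) : cantorMeasure l n Set.univ = 1 := by
  classical
  rw [cantorMeasure_apply]
  simp only [Set.mem_univ, Finset.filter_true, Finset.card_range]
  push_cast
  rw [← mul_pow, ENNReal.inv_mul_cancel (by simp) (by simp), one_pow]

lemma exists_angle_of_mem_carlesonBox {n i : ℕ} (h1 : l n < 1) {θ ℓ : ℝ} (hℓ : ℓ ≤ 1)
    (h : diskPoint l n i ∈ carlesonBox θ ℓ) :
    l n < ℓ ∧ ∃ m : ℤ, cantorPoint l n i + m * (2 * Real.pi) ∈ Set.Icc θ (θ + ℓ) := by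
  obtain ⟨r, α, hr, -, hα, hα', hz⟩ := h
  have hnorm := congrArg norm hz
  rw [norm_diskPoint h1.le, norm_mul, Complex.norm_exp_ofReal_mul_I, mul_one, Complex.norm_real,
    Real.norm_of_nonneg (by linarith)] at hnorm
  refine ⟨by linarith, ?_⟩
  rw [diskPoint, ← hnorm] at hz
  have hne : ((1 - l n : ℝ) : ℂ) ≠ 0 := Complex.ofReal_ne_zero.2 (by linarith)
  obtain ⟨m, hm⟩ := Complex.exp_eq_exp_iff_exists_int.1 (mul_left_cancel₀ hne hz).symm
  refine ⟨m, ?_⟩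
  have hm' : α = cantorPoint l n i + m * (2 * Real.pi) := by
    have him := congrArg Complex.im hm
    simpa using him
  exact hm' ▸ ⟨hα, hα'⟩

lemma cantorMeasure_carlesonBox_le (hpos : ∀ n, 0 < l n) (h2 : ∀ n, 2 * l (n + 1) ≤ l n)
    (h0 : l 0 ≤ 1 / 2) (n : ℕ) {θ ℓ : ℝ} (hℓ : ℓ < l 0) {b : ℝ}
    (hb : ∀ j, l j ≤ ℓ → (1 / 2) ^ j ≤ b) :
    cantorMeasure l n (carlesonBox θ ℓ) ≤ ENNReal.ofReal (4 * b) := by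
  classical
  have h1 : Antitone l := antitone_nat_of_succ_le fun n => by linarith [h2 n, hpos (n + 1)]
  have hn1 : l n < 1 := (h1 (Nat.zero_le n)).trans_lt (by linarith)
  rw [cantorMeasure_apply]
  set A := (Finset.range (2 ^ n)).filter fun i => diskPoint l n i ∈ carlesonBox θ ℓ
  rcases A.eq_empty_or_nonempty with hA | ⟨a₀, ha₀⟩
  · simp [hA]
  have hang : ∀ a ∈ A, _ := fun a ha =>
    exists_angle_of_mem_carlesonBox hn1 (by linarith) (Finset.mem_filter.1 ha).2
  have hex : ∃ j, l j ≤ ℓ := ⟨n, (hang a₀ ha₀).1.le⟩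
  obtain ⟨j, hj⟩ : ∃ j, Nat.find hex = j + 1 := Nat.exists_eq_succ_of_ne_zero fun hz =>
    absurd (hz ▸ Nat.find_spec hex) (not_le.2 hℓ)
  have hjℓ : l (j + 1) ≤ ℓ := hj ▸ Nat.find_spec hex
  have hℓj : ℓ < l j := not_le.1 (Nat.find_min hex (by omega))
  have hjn : j + 1 ≤ n := hj ▸ Nat.find_min' hex (hang a₀ ha₀).1.le
  have hcard : A.card ≤ 2 * 2 ^ (n - j) := by
    refine card_le_of_cantorPoint_close hpos h2 (by omega) A fun a ha a' ha' => ?_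
    obtain ⟨-, m, hm⟩ := hang a ha
    obtain ⟨-, m', hm'⟩ := hang a' ha'
    have hta := cantorPoint_mem_Icc hpos h2 (Finset.mem_range.1 (Finset.mem_filter.1 ha).1)
    have hta' := cantorPoint_mem_Icc hpos h2 (Finset.mem_range.1 (Finset.mem_filter.1 ha').1)
    obtain ⟨hm1, hm2⟩ := hm
    obtain ⟨hm1', hm2'⟩ := hm'
    obtain ⟨ht1, ht2⟩ := hta
    obtain ⟨ht1', ht2'⟩ := hta'
    have hpi := Real.pi_gt_three
    have hmm : m = m' := by
      have hlt : |((m - m' : ℤ) : ℝ)| < 1 := by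
        push_cast
        rw [abs_lt]
        constructor <;> nlinarith
      have := Int.abs_lt_one_iff.1 (by exact_mod_cast hlt)
      omega
    subst hmm
    linarith
  have hreal : ((1 : ℝ) / 2) ^ n * A.card ≤ 4 * b := by
    calc ((1 : ℝ) / 2) ^ n * A.card ≤ (1 / 2) ^ n * (2 * 2 ^ (n - j)) := by
          gcongr
          exact_mod_cast hcard
      _ = 4 * (1 / 2) ^ (j + 1) := by
          obtain ⟨k, rfl⟩ := Nat.exists_eq_add_of_le (Nat.le_of_succ_le hjn)
          rw [Nat.add_sub_cancel_left, pow_add, pow_succ, one_div, inv_pow, inv_pow]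
          field_simp
          norm_num
      _ ≤ 4 * b := by gcongr; exact hb _ hjℓ
  refine le_trans (le_of_eq ?_) (ENNReal.ofReal_le_ofReal hreal)
  rw [ENNReal.ofReal_mul (by positivity), ENNReal.ofReal_pow (by norm_num), one_div,
    ENNReal.ofReal_inv_of_pos (by norm_num)]
  simp

lemma cantorLog_le_neg_log (hpos : ∀ n, 0 < l n) (h1 : Antitone l) (h0 : l 0 ≤ 1 / 2) {n i i' : ℕ}
    (hi : i < 2 ^ n) (hi' : i' < 2 ^ n) :
    cantorLog l n i i' ≤
      -Real.log ‖1 - diskPoint l n i * (starRingEnd ℂ) (diskPoint l n i')‖ := by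
  have hn1 : l n ≤ 1 / 2 := (h1 (Nat.zero_le n)).trans h0
  have hn0 := hpos n
  set s := cantorPoint l n i - cantorPoint l n i' with hs
  have hprod : diskPoint l n i * (starRingEnd ℂ) (diskPoint l n i') =
      (((1 - l n) ^ 2 : ℝ) : ℂ) * Complex.exp (Complex.I * s) := by
    rw [diskPoint, diskPoint, map_mul, Complex.conj_ofReal, ← Complex.exp_conj, map_mul,
      Complex.conj_ofReal, Complex.conj_I]
    have e : Complex.exp (Complex.I * s) = Complex.exp (cantorPoint l n i * Complex.I) *
        Complex.exp (cantorPoint l n i' * -Complex.I) := by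
      rw [← Complex.exp_add, hs]
      congr 1
      push_cast
      ring
    rw [e]
    push_cast
    ring
  have hlt : ‖diskPoint l n i * (starRingEnd ℂ) (diskPoint l n i')‖ < 1 := by
    rw [norm_mul, RCLike.norm_conj, norm_diskPoint (by linarith), norm_diskPoint (by linarith)]
    nlinarith
  have hposn : 0 < ‖1 - diskPoint l n i * (starRingEnd ℂ) (diskPoint l n i')‖ := by
    have := norm_sub_norm_le (1 : ℂ) (diskPoint l n i * (starRingEnd ℂ) (diskPoint l n i'))
    rw [norm_one] at this
    linarith
  have hle : ‖1 - diskPoint l n i * (starRingEnd ℂ) (diskPoint l n i')‖ ≤ 2 * l n + |s| := by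
    rw [hprod]
    have e : (1 : ℂ) - (((1 - l n) ^ 2 : ℝ) : ℂ) * Complex.exp (Complex.I * s) =
        ((1 - (1 - l n) ^ 2 : ℝ) : ℂ) -
          (((1 - l n) ^ 2 : ℝ) : ℂ) * (Complex.exp (Complex.I * s) - 1) := by
      push_cast
      ring
    rw [e]
    refine (norm_sub_le _ _).trans ?_
    have hexp : ‖Complex.exp (Complex.I * s) - 1‖ ≤ |s| := Real.norm_exp_I_mul_ofReal_sub_one_le
    rw [norm_mul, Complex.norm_real, Complex.norm_real, Real.norm_of_nonneg (by nlinarith),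
      Real.norm_of_nonneg (by positivity)]
    have hb : (1 - l n) ^ 2 ≤ 1 := by nlinarith
    nlinarith [mul_le_mul hb hexp (norm_nonneg _) zero_le_one, sq_nonneg (l n)]
  have hdist := abs_cantorPoint_sub_le hpos h1 n hi hi'
  rw [← hs] at hdist
  have hfin : ‖1 - diskPoint l n i * (starRingEnd ℂ) (diskPoint l n i')‖ ≤
      Real.exp (-cantorLog l n i i') := by
    nlinarith [abs_nonneg s, Real.exp_pos (-cantorLog l n i i')]
  have := Real.log_le_log hposn hfin
  rw [Real.log_exp] at this
  linarith

lemma partialEnergy_sq_le_lintegral (n K : ℕ) :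
    ENNReal.ofReal (partialEnergy (diskPoint l n) (2 ^ n) K ^ 2) ≤
      ∫⁻ z, ENNReal.ofReal (‖truncPotential (diskPoint l n) (2 ^ n) K z‖ ^ 2)
        ∂(cantorMeasure l n) := by
  refine (ENNReal.ofReal_le_ofReal (partialEnergy_sq_le _ _ _)).trans (le_of_eq ?_)
  rw [lintegral_cantorMeasure, ENNReal.ofReal_mul (by positivity),
    ENNReal.ofReal_sum_of_nonneg fun i _ => by positivity]
  congr 1
  push_cast
  rw [← inv_pow, ENNReal.ofReal_pow (by norm_num), ENNReal.ofReal_inv_of_pos (by norm_num)]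
  simp

/-- A Carleson-type bound for `cantorMeasure l n` dominates its logarithmic energy. -/
lemma sum_log_le_of_carleson (hpos : ∀ n, 0 < l n) (h2 : ∀ n, 2 * l (n + 1) ≤ l n)
    (h0 : l 0 ≤ 1 / 2) (n : ℕ) {M : ℝ} (hM : 0 ≤ M)
    (h : ∀ f, InDirichlet f → ∫⁻ z, ENNReal.ofReal (‖f z‖ ^ 2) ∂(cantorMeasure l n) ≤
      ENNReal.ofReal (M * dirichletNormSq f)) :
    ∑ j ∈ Finset.range n, (1 / 2) ^ (j + 1) * Real.log (l j / l (j + 1)) ≤ M := by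
  have h1 : Antitone l := antitone_nat_of_succ_le fun n => by linarith [h2 n, hpos (n + 1)]
  have hn1 : l n ≤ 1 := (h1 (Nat.zero_le n)).trans (by linarith)
  have hK : ∀ K, partialEnergy (diskPoint l n) (2 ^ n) K ≤ M := by
    intro K
    have hf := (partialEnergy_sq_le_lintegral n K).trans
      (h _ (inDirichlet_truncPotential (diskPoint l n) (2 ^ n) K))
    have hQ := partialEnergy_nonneg (diskPoint l n) (2 ^ n) K
    rw [dirichletNormSq_truncPotential, ENNReal.ofReal_le_ofReal_iff (by positivity)] at hf
    rcases hQ.eq_or_lt with h | h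
    · rwa [← h]
    · exact le_of_mul_le_mul_right (by rwa [← sq]) h
  have hle := le_of_partialEnergy_le (fun i _ => by
    rw [norm_diskPoint hn1]
    linarith [hpos n]) hK
  refine le_trans ?_ hle
  calc _ = ((2 ^ n : ℕ) : ℝ)⁻¹ ^ 2 * ∑ i ∈ Finset.range (2 ^ n), ∑ i' ∈ Finset.range (2 ^ n),
        cantorLog l n i i' := by
        rw [sum_cantorLog, show (4 : ℝ) ^ n = 2 ^ n * 2 ^ n by rw [← mul_pow]; norm_num]
        push_cast
        field_simp
    _ ≤ _ := by
        gcongr with i hi i' hi'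
        exact cantorLog_le_neg_log hpos h1 h0 (Finset.mem_range.1 hi) (Finset.mem_range.1 hi')

end CantorMeasure

/-- **Theorem 2 (sharpness of the one-box condition).** If `φ` is continuous, increasing
and positive on `(0, 2π]`, `φ(x)/x` is strictly decreasing, and `∫₀^{2π} φ(x)/x dx = ∞`,
then there is a finite Borel measure `μ` on the unit disk satisfying the one-box condition
`μ(S(I)) = O(φ(|I|))` which is not a Carleson measure for the Dirichlet space. -/
theorem statement1 (φ : ℝ → ℝ)
    (hφcont : ContinuousOn φ (Set.Ioc (0:ℝ) (2 * Real.pi)))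
    (hφpos : ∀ x ∈ Set.Ioc (0:ℝ) (2 * Real.pi), 0 < φ x)
    (hφmono : MonotoneOn φ (Set.Ioc (0:ℝ) (2 * Real.pi)))
    (hφratio : StrictAntiOn (fun x => φ x / x) (Set.Ioc (0:ℝ) (2 * Real.pi)))
    (hφint : ∫⁻ x in Set.Ioc (0:ℝ) (2 * Real.pi), ENNReal.ofReal (φ x / x) = ⊤) :
    ∃ μ : Measure ℂ, IsFiniteMeasure μ ∧ μ (Metric.ball (0:ℂ) 1)ᶜ = 0 ∧
      (∃ C > (0:ℝ), ∃ ε > (0:ℝ), ∀ θ ℓ : ℝ, 0 < ℓ → ℓ < ε →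
        μ (carlesonBox θ ℓ) ≤ ENNReal.ofReal (C * φ ℓ)) ∧
      ¬ IsCarlesonDirichlet μ := by
  obtain ⟨l, C, hC, hpos, h2, h0, hφl, hdiv⟩ :=
    exists_scales φ hφcont hφpos hφmono hφratio hφint
  have h1 : Antitone l := antitone_nat_of_succ_le fun n => by linarith [h2 n, hpos (n + 1)]
  have hl1 : ∀ n, l n ≤ 1 := fun n => (h1 (Nat.zero_le n)).trans (by linarith)
  have hpi := Real.pi_gt_three
  choose n hn using fun k : ℕ => hdiv (4 ^ k)
  set μ := Measure.sum fun k => (2⁻¹ : ENNReal) ^ k • cantorMeasure l (n k) with hμ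
  have hgeom : ∑' k : ℕ, (2⁻¹ : ENNReal) ^ k = 2 := by
    rw [ENNReal.tsum_geometric, ENNReal.one_sub_inv_two, inv_inv]
  have hcompl : μ (ball (0 : ℂ) 1)ᶜ = 0 := by
    simp [hμ, Measure.sum_apply_of_countable, cantorMeasure_compl_ball (hpos _) (hl1 _)]
  refine ⟨μ, ⟨?_⟩, hcompl, ⟨8 * C, by positivity, l 0, hpos 0, ?_⟩, ?_⟩
  · simp [hμ, cantorMeasure_univ, hgeom]
  · intro θ ℓ hℓ0 hℓ
    have hbox : ∀ k, cantorMeasure l (n k) (carlesonBox θ ℓ) ≤ ENNReal.ofReal (4 * (C * φ ℓ)) :=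
      fun k => cantorMeasure_carlesonBox_le hpos h2 h0 _ hℓ fun j hj => (hφl j).trans <|
        mul_le_mul_of_nonneg_left (hφmono ⟨hpos j, by linarith [hl1 j]⟩
          ⟨hℓ0, by linarith⟩ hj) hC.le
    rw [hμ, Measure.sum_apply_of_countable]
    calc ∑' k, ((2⁻¹ : ENNReal) ^ k • cantorMeasure l (n k)) (carlesonBox θ ℓ)
        ≤ ∑' k : ℕ, (2⁻¹ : ENNReal) ^ k * ENNReal.ofReal (4 * (C * φ ℓ)) :=
          ENNReal.tsum_le_tsum fun k => mul_le_mul_right (hbox k) _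
      _ = ENNReal.ofReal (8 * C * φ ℓ) := by
          rw [ENNReal.tsum_mul_right, hgeom, ← ENNReal.ofReal_ofNat 2,
            ← ENNReal.ofReal_mul (by norm_num)]
          congr 1
          ring
  · rintro ⟨B, hB⟩
    have hrestr : μ.restrict (ball (0 : ℂ) 1) = μ :=
      Measure.restrict_eq_self_of_ae_mem (mem_ae_iff.2 hcompl)
    rw [hrestr] at hB
    have hbound : ∀ k, (2 : ℝ) ^ k ≤ |B| := by
      intro k
      have hk : (4 : ℝ) ^ k ≤ 2 ^ k * |B| := by
        refine (hn k).trans (sum_log_le_of_carleson hpos h2 h0 (n k) (by positivity)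
          fun f hf => ?_)
        have hD : 0 ≤ dirichletNormSq f := by unfold dirichletNormSq; positivity
        have hle : (2⁻¹ : ENNReal) ^ k * ∫⁻ z, ENNReal.ofReal (‖f z‖ ^ 2) ∂(cantorMeasure l (n k)) ≤
            ENNReal.ofReal (|B| * dirichletNormSq f) := by
          refine le_trans ?_ ((hB f hf).trans (ENNReal.ofReal_le_ofReal
            (mul_le_mul_of_nonneg_right (le_abs_self B) hD)))
          rw [hμ, lintegral_sum_measure]
          refine le_trans (le_of_eq ?_) (ENNReal.le_tsum k)
          rw [lintegral_smul_measure, smul_eq_mul]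
        calc ∫⁻ z, ENNReal.ofReal (‖f z‖ ^ 2) ∂(cantorMeasure l (n k))
            = 2 ^ k * ((2⁻¹ : ENNReal) ^ k *
                ∫⁻ z, ENNReal.ofReal (‖f z‖ ^ 2) ∂(cantorMeasure l (n k))) := by
              rw [← mul_assoc, ← mul_pow, ENNReal.mul_inv_cancel (by simp) (by simp), one_pow,
                one_mul]
          _ ≤ 2 ^ k * ENNReal.ofReal (|B| * dirichletNormSq f) := by gcongr
          _ = ENNReal.ofReal (2 ^ k * |B| * dirichletNormSq f) := by
              rw [mul_assoc, ENNReal.ofReal_mul (p := 2 ^ k) (by positivity),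
                ENNReal.ofReal_pow (by norm_num), ENNReal.ofReal_ofNat]
      have e : (4 : ℝ) ^ k = 2 ^ k * 2 ^ k := by rw [← mul_pow]; norm_num
      rw [e] at hk
      exact le_of_mul_le_mul_left hk (by positivity)
    obtain ⟨k, hk⟩ := pow_unbounded_of_one_lt |B| (one_lt_two (α := ℝ))
    linarith [hbound k]

end
end

section
/- Let α > 1 and let μ be a finite positive Borel measure on the open unit disk 𝔻 satisfying μ(S(I)) = O((log(1/|I|))^{-1} (log log(1/|I|))^{-α}) as |I| → 0. Then μ is a Carleson measure for the Dirichlet space 𝒟. -/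
open MeasureTheory Metric Complex Filter Set

noncomputable section

/-- Subharmonicity of `‖g‖²` on circles. -/
theorem lintegral_circle_ge {g : ℂ → ℂ} {c : ℂ} {r R : ℝ} (hr : 0 < r) (hrR : r < R)
    (hg : DifferentiableOn ℂ g (ball c R)) :
    ENNReal.ofReal (2 * Real.pi) * ‖g c‖ₑ ^ 2 ≤
      ∫⁻ θ in Ioo (-Real.pi) Real.pi, ‖g (circleMap c r θ)‖ₑ ^ 2 := by
  have hd : DiffContOnCl ℂ (fun z => g z ^ 2) (ball c |r|) := by
    apply DifferentiableOn.diffContOnCl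
    rw [abs_of_pos hr, closure_ball c hr.ne']
    exact (hg.mono (closedBall_subset_ball hrR)).pow 2
  have h1 := hd.circleAverage
  rw [Real.circleAverage_eq_integral_add (-Real.pi), intervalIntegral.integral_comp_add_right
    (fun θ => g (circleMap c r θ) ^ 2)] at h1
  have hpi := Real.pi_pos
  have h2 : (2 * Real.pi : ℝ) • g c ^ 2 = ∫ θ in Ioo (-Real.pi) Real.pi, g (circleMap c r θ) ^ 2 := by
    rw [← h1, smul_smul, mul_inv_cancel₀ (by positivity), one_smul,
      intervalIntegral.integral_of_le (by linarith), integral_Ioc_eq_integral_Ioo]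
    ring_nf
  calc ENNReal.ofReal (2 * Real.pi) * ‖g c‖ₑ ^ 2 = ‖(2 * Real.pi : ℝ) • g c ^ 2‖ₑ := by
        rw [enorm_smul, enorm_pow, Real.enorm_of_nonneg (by positivity)]
    _ ≤ _ := by
        rw [h2]
        refine (enorm_integral_le_lintegral_enorm _).trans_eq ?_
        simp_rw [enorm_pow]

/-- Subharmonicity of `‖g‖²` on disks. -/
theorem enorm_sq_le_lintegral_ball {g : ℂ → ℂ} {c : ℂ} {R : ℝ} (hR : 0 ≤ R) (hm : Measurable g)
    (hg : DifferentiableOn ℂ g (ball c R)) :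
    ENNReal.ofReal (Real.pi * R ^ 2) * ‖g c‖ₑ ^ 2 ≤ ∫⁻ w in ball c R, ‖g w‖ₑ ^ 2 := by
  have hpi := Real.pi_pos
  have hmF : Measurable ((ball c R).indicator fun w => ‖g w‖ₑ ^ 2) :=
    (hm.enorm.pow_const 2).indicator measurableSet_ball
  have key : ∀ p : ℝ × ℝ, c + Complex.polarCoord.symm p = circleMap c p.1 p.2 := by
    intro p
    simp [circleMap, Complex.polarCoord_symm_apply, Complex.exp_mul_I]
  have hcm : Measurable fun p : ℝ × ℝ => circleMap c p.1 p.2 := by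
    unfold circleMap; fun_prop
  calc ENNReal.ofReal (Real.pi * R ^ 2) * ‖g c‖ₑ ^ 2
      = ∫⁻ r in Ioo 0 R, ENNReal.ofReal r * (ENNReal.ofReal (2 * Real.pi) * ‖g c‖ₑ ^ 2) := by
        rw [lintegral_mul_const _ (by fun_prop), ← ofReal_integral_eq_lintegral_ofReal,
          ← integral_Ioc_eq_integral_Ioo, ← intervalIntegral.integral_of_le hR, integral_id,
          ← mul_assoc, ← ENNReal.ofReal_mul]
        · congr 2; ring
        · nlinarith
        · exact (continuous_id.integrableOn_Icc (a := 0) (b := R)).mono_set Ioo_subset_Icc_self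
        · exact (ae_restrict_iff' measurableSet_Ioo).2 (.of_forall fun x hx => hx.1.le)
    _ ≤ ∫⁻ r in Ioo 0 R, ENNReal.ofReal r * ∫⁻ θ in Ioo (-Real.pi) Real.pi,
          ‖g (circleMap c r θ)‖ₑ ^ 2 := by
        refine setLIntegral_mono' measurableSet_Ioo fun r hr => ?_
        gcongr
        exact lintegral_circle_ge hr.1 hr.2 hg
    _ = ∫⁻ r in Ioo 0 R, ∫⁻ θ in Ioo (-Real.pi) Real.pi,
          ENNReal.ofReal r • (ball c R).indicator (fun w => ‖g w‖ₑ ^ 2) (circleMap c r θ) := by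
        refine setLIntegral_congr_fun measurableSet_Ioo fun r hr => ?_
        have : ∀ θ, circleMap c r θ ∈ ball c R := fun θ => by
          simp [circleMap, abs_of_pos hr.1, hr.2]
        simp only [indicator_of_mem (this _), smul_eq_mul]
        rw [lintegral_const_mul]
        exact (hm.comp (hcm.comp measurable_prodMk_left)).enorm.pow_const 2
    _ ≤ ∫⁻ r in Ioi 0, ∫⁻ θ in Ioo (-Real.pi) Real.pi,
          ENNReal.ofReal r • (ball c R).indicator (fun w => ‖g w‖ₑ ^ 2) (circleMap c r θ) :=
        lintegral_mono_set Ioo_subset_Ioi_self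
    _ = ∫⁻ w, (ball c R).indicator (fun w => ‖g w‖ₑ ^ 2) (c + w) := by
        rw [← Complex.lintegral_comp_polarCoord_symm, polarCoord_target, Measure.volume_eq_prod,
          ← Measure.prod_restrict, lintegral_prod]
        · simp_rw [key]
        · simp_rw [key]
          exact ((measurable_fst.ennreal_ofReal).mul (hmF.comp hcm)).aemeasurable
    _ = _ := by
        rw [lintegral_add_left_eq_self, lintegral_indicator measurableSet_ball]

/-- The Cauchy-Schwarz inequality with a weight `k`. -/
theorem sq_lintegral_le {X : Type*} [MeasurableSpace X] (ν : Measure X) {k x : X → ENNReal}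
    (hk : Measurable k) (hx : Measurable x) (h0 : ∀ᵐ t ∂ν, k t ≠ 0) (h1 : ∀ᵐ t ∂ν, k t ≠ ⊤) :
    (∫⁻ t, x t ∂ν) ^ 2 ≤ (∫⁻ t, k t ∂ν) * ∫⁻ t, x t ^ 2 / k t ∂ν := by
  have h := ENNReal.lintegral_mul_le_Lp_mul_Lq ν (p := 2) (q := 2)
    (by constructor <;> norm_num)
    (f := fun t => k t ^ (1 / 2 : ℝ)) (g := fun t => x t / k t ^ (1 / 2 : ℝ))
    (hk.pow_const _).aemeasurable (hx.div (hk.pow_const _)).aemeasurable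
  have e0 : ∫⁻ t, x t ∂ν = ∫⁻ t, ((fun t => k t ^ (1 / 2 : ℝ)) *
      fun t => x t / k t ^ (1 / 2 : ℝ)) t ∂ν := by
    refine lintegral_congr_ae ?_
    filter_upwards [h0, h1] with t h0 h1
    simp only [Pi.mul_apply]
    rw [ENNReal.mul_div_cancel] <;> simp [h0, h1]
  have e1 : ∀ t, (k t ^ (1 / 2 : ℝ)) ^ (2 : ℝ) = k t := fun t => by
    rw [← ENNReal.rpow_mul]; norm_num
  have e2 : ∀ t, (x t / k t ^ (1 / 2 : ℝ)) ^ (2 : ℝ) = x t ^ 2 / k t := fun t => by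
    rw [ENNReal.div_rpow_of_nonneg _ _ (by norm_num), e1, ENNReal.rpow_two]
  simp_rw [e1, e2] at h
  rw [e0]
  refine (pow_le_pow_left₀ zero_le h 2).trans_eq ?_
  rw [← ENNReal.mul_rpow_of_nonneg _ _ (by norm_num), ← ENNReal.rpow_two, ← ENNReal.rpow_mul]
  norm_num

/-- The radial projection of `z` to the unit circle, with `0` sent to `0`. -/
def radialDir (z : ℂ) : ℂ := z / ‖z‖

theorem measurable_radialDir : Measurable radialDir := by
  unfold radialDir; fun_prop

theorem norm_radialDir {z : ℂ} (hz : z ≠ 0) : ‖radialDir z‖ = 1 := by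
  simp [radialDir, hz]

theorem norm_radialDir_le (z : ℂ) : ‖radialDir z‖ ≤ 1 := by
  rcases eq_or_ne z 0 with rfl | hz
  · simp [radialDir]
  · exact (norm_radialDir hz).le

theorem norm_mul_radialDir (z : ℂ) : (‖z‖ : ℂ) * radialDir z = z := by
  rcases eq_or_ne z 0 with rfl | hz
  · simp
  · rw [radialDir, mul_div_cancel₀]
    simpa using hz

/-- The points `z` whose radius passes within `δ / 2` of `w` at depth `δ`. -/
def shadow (δ : ℝ) (w : ℂ) : Set ℂ :=
  {z | 1 - δ < ‖z‖ ∧ ‖z‖ < 1 ∧ ‖w - (1 - δ : ℝ) * radialDir z‖ < δ / 2}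

theorem enorm_sub_le_lintegral_radial {f : ℂ → ℂ} (hf : DifferentiableOn ℂ f (ball 0 1))
    {z : ℂ} (hz : z ∈ ball (0 : ℂ) 1) :
    ‖f z - f 0‖ₑ ≤ ∫⁻ δ in Ioo (0 : ℝ) 1,
      {δ : ℝ | 1 - δ < ‖z‖}.indicator (fun δ => ‖deriv f ((1 - δ : ℝ) * radialDir z)‖ₑ) δ := by
  have hz' : ‖z‖ < 1 := by simpa using hz
  have hball : ∀ δ ∈ Icc (1 - ‖z‖) 1, ((1 - δ : ℝ) : ℂ) * radialDir z ∈ ball (0 : ℂ) 1 := by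
    intro δ hδ
    rw [mem_ball_zero_iff, norm_mul, Complex.norm_real, Real.norm_of_nonneg (by linarith [hδ.2])]
    have := norm_radialDir_le z
    have := norm_nonneg (radialDir z)
    nlinarith [hδ.1, hδ.2]
  have hd : ∀ δ ∈ Icc (1 - ‖z‖) 1, HasDerivAt (fun δ : ℝ => f ((1 - δ : ℝ) * radialDir z))
      (deriv f ((1 - δ : ℝ) * radialDir z) * -radialDir z) δ := by
    intro δ hδ
    have h1 := (hf.differentiableAt (isOpen_ball.mem_nhds (hball δ hδ))).hasDerivAt
    have h2 : HasDerivAt (fun δ : ℝ => ((1 - δ : ℝ) : ℂ) * radialDir z) (-radialDir z) δ := by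
      have := (((hasDerivAt_id δ).const_sub 1).ofReal_comp).mul_const (radialDir z)
      simpa using this
    exact h1.comp δ h2
  have hc : ContDiffOn ℝ 1 (fun δ : ℝ => f ((1 - δ : ℝ) * radialDir z)) (Icc (1 - ‖z‖) 1) := by
    have hcf : ContDiffOn ℝ 1 f (ball 0 1) := (hf.contDiffOn isOpen_ball).restrict_scalars ℝ
    refine hcf.comp ?_ hball
    have : ContDiff ℝ 1 (fun δ : ℝ => ((1 - δ : ℝ) : ℂ) * radialDir z) :=
      (Complex.ofRealCLM.contDiff.comp (contDiff_const.sub contDiff_id)).mul contDiff_const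
    exact this.contDiffOn
  have h := enorm_sub_le_lintegral_deriv_of_contDiffOn_Icc hc (by linarith [norm_nonneg z])
  have e : ‖f z - f 0‖ₑ = ‖f ((1 - 1 : ℝ) * radialDir z) -
      f ((1 - (1 - ‖z‖) : ℝ) * radialDir z)‖ₑ := by
    rw [sub_self, sub_sub_cancel, norm_mul_radialDir, ← enorm_neg]
    simp
  rw [e]
  refine h.trans ?_
  rw [setLIntegral_congr Ioo_ae_eq_Icc.symm]
  refine (setLIntegral_mono' measurableSet_Ioo fun δ hδ => ?_).trans
    (lintegral_mono_set (Ioo_subset_Ioo_left (by linarith : 0 ≤ 1 - ‖z‖)))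
  rw [indicator_of_mem (by simp only [mem_ofPred_eq]; linarith [hδ.1]),
    (hd δ (Ioo_subset_Icc_self hδ)).deriv, enorm_mul, enorm_neg]
  refine mul_le_of_le_one_right zero_le ?_
  rw [← ofReal_norm]
  exact ENNReal.ofReal_le_one.2 (norm_radialDir_le z)

theorem shadow_subset_carlesonBox {δ : ℝ} (hδ : 0 < δ) (hδ' : δ ≤ 1 / 2) (w : ℂ) :
    ∃ θ, shadow δ w ⊆ carlesonBox θ (8 * δ) := by
  rcases (shadow δ w).eq_empty_or_nonempty with h | ⟨y, hy1, hy2, hy3⟩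
  · exact ⟨0, by simp [h]⟩
  have hy0 : y ≠ 0 := norm_pos_iff.1 (by linarith)
  refine ⟨arg (radialDir y) - 4 * δ, ?_⟩
  rintro z ⟨hz1, hz2, hz3⟩
  have hz0 : z ≠ 0 := norm_pos_iff.1 (by linarith)
  have hz4 := norm_radialDir hz0
  have hy4 := norm_radialDir hy0
  have hd : ‖radialDir z - radialDir y‖ ≤ 2 * δ := by
    have h1 : ‖((1 - δ : ℝ) : ℂ) * (radialDir z - radialDir y)‖ ≤ δ := by
      have : ((1 - δ : ℝ) : ℂ) * (radialDir z - radialDir y) =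
          (w - (1 - δ : ℝ) * radialDir y) - (w - (1 - δ : ℝ) * radialDir z) := by ring
      rw [this]
      refine (norm_sub_le _ _).trans (by linarith)
    rw [norm_mul, Complex.norm_real, Real.norm_of_nonneg (by linarith)] at h1
    nlinarith [norm_nonneg (radialDir z - radialDir y)]
  have hang := Complex.angle_le_mul_norm_sub hz4 hy4
  have hz5 : radialDir z ≠ 0 := norm_pos_iff.1 (by linarith)
  have hy5 : radialDir y ≠ 0 := norm_pos_iff.1 (by linarith)
  rw [Complex.angle_eq_abs_arg hz5 hy5] at hang
  have harg : |(radialDir z / radialDir y).arg| ≤ 4 * δ := by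
    refine hang.trans ?_
    have := Real.pi_le_four
    have := Real.pi_pos
    nlinarith [norm_nonneg (radialDir z - radialDir y)]
  rw [abs_le] at harg
  refine ⟨‖z‖, arg (radialDir y) + arg (radialDir z / radialDir y), by linarith, hz2,
    by linarith, by linarith, ?_⟩
  have e1 := Complex.norm_mul_exp_arg_mul_I (radialDir y)
  have e2 := Complex.norm_mul_exp_arg_mul_I (radialDir z / radialDir y)
  rw [norm_div, hz4, hy4] at e2
  rw [hy4] at e1
  simp only [ofReal_one, div_one, one_mul] at e1 e2
  rw [ofReal_add, add_mul, Complex.exp_add, e1, e2, mul_div_cancel₀ _ hy5, norm_mul_radialDir]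

theorem one_lt_log_one_div {δ : ℝ} (h0 : 0 < δ) (h1 : δ ≤ 1 / 1000) :
    1 < Real.log (1 / (8 * δ)) := by
  rw [Real.lt_log_iff_exp_lt (by positivity), lt_div_iff₀ (by positivity)]
  nlinarith [Real.exp_one_lt_d9]

theorem integrableOn_logWeight {α a : ℝ} (hα : 1 < α) (ha' : a ≤ 1 / 1000) :
    IntegrableOn (fun δ : ℝ => (Real.log (1 / (8 * δ)))⁻¹ *
      (Real.log (Real.log (1 / (8 * δ)))) ^ (-α) / δ) (Ioc 0 a) := by
  have hL : ∀ δ, 0 < δ → δ ≤ a → 1 < Real.log (1 / (8 * δ)) :=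
    fun δ h0 h1 => one_lt_log_one_div h0 (h1.trans ha')
  refine intervalIntegral.integrableOn_deriv_of_nonneg
    (g := fun δ => (Real.log (Real.log (1 / (8 * δ)))) ^ (1 - α) / (α - 1)) ?_ ?_ ?_
  · intro δ hδ
    rcases hδ.1.eq_or_lt with rfl | h0
    · apply ContinuousWithinAt.div_const
      rw [← continuousWithinAt_sdiff_self]
      have e : Real.log (Real.log (1 / (8 * 0))) ^ (1 - α) = 0 := by
        simp only [mul_zero, div_zero, Real.log_zero]
        exact Real.zero_rpow (by linarith)
      unfold ContinuousWithinAt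
      beta_reduce
      rw [e]
      have t1 : Tendsto (fun x : ℝ => 1 / (8 * x)) (nhdsWithin 0 (Icc 0 a \ {0})) atTop := by
        have : Tendsto (fun x : ℝ => 8⁻¹ * x⁻¹) (nhdsWithin 0 (Ioi 0)) atTop :=
          tendsto_inv_nhdsGT_zero.const_mul_atTop (by norm_num)
        refine (this.mono_left (nhdsWithin_mono _ ?_)).congr fun x => ?_
        · rintro x ⟨hx, hx0⟩
          exact lt_of_le_of_ne hx.1 (Ne.symm hx0)
        · rw [one_div, mul_inv]
      have t2 := Real.tendsto_log_atTop.comp (Real.tendsto_log_atTop.comp t1)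
      have t3 := (tendsto_rpow_neg_atTop (y := α - 1) (by linarith)).comp t2
      simpa [Function.comp_def] using t3
    · have h1 := hL δ h0 hδ.2
      have h2 := Real.log_pos h1
      apply ContinuousAt.continuousWithinAt
      apply ContinuousAt.div_const
      refine ContinuousAt.rpow_const ?_ (Or.inl h2.ne')
      refine ContinuousAt.log (ContinuousAt.log ?_ (by positivity)) (by positivity)
      exact continuousAt_const.div (by fun_prop) (by positivity)
  · intro δ hδ
    have h0 := hδ.1
    have h1 := hL δ hδ.1 hδ.2.le
    have h2 := Real.log_pos h1
    have d1 : HasDerivAt (fun δ : ℝ => 1 / (8 * δ)) (-(8 : ℝ) / (8 * δ) ^ 2) δ := by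
      have := ((hasDerivAt_id δ).const_mul 8).fun_inv (by simpa using h0.ne')
      simpa only [one_div, id, mul_one] using this
    have d4 := (((d1.log (by positivity)).log (by positivity)).rpow_const (p := 1 - α)
      (Or.inl h2.ne')).div_const (α - 1)
    convert! d4 using 1
    have : α - 1 ≠ 0 := by linarith
    have e : 1 - α - 1 = -α := by ring
    rw [e]
    have : Real.log (1 / (8 * δ)) ≠ 0 := by positivity
    field_simp
    ring
  · intro δ hδ
    have h0 := hδ.1
    have h1 := hL δ hδ.1 hδ.2.le
    have h2 := Real.log_pos h1
    positivity

theorem exists_weight {α : ℝ} (hα : 1 < α) (μ : Measure ℂ) [IsFiniteMeasure μ]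
    (hbox : ∃ C > (0:ℝ), ∃ ε > (0:ℝ), ∀ θ ℓ : ℝ, 0 < ℓ → ℓ < ε →
      μ (carlesonBox θ ℓ) ≤ ENNReal.ofReal
        (C * ((Real.log (1/ℓ))⁻¹ * (Real.log (Real.log (1/ℓ))) ^ (-α)))) :
    ∃ v : ℝ → ENNReal, Measurable v ∧ (∀ δ ∈ Ioo (0 : ℝ) 1, v δ ≠ 0 ∧ v δ ≠ ⊤) ∧
      ∫⁻ δ in Ioo (0 : ℝ) 1, v δ / ENNReal.ofReal δ ≠ ⊤ ∧
      ∃ K : ENNReal, K ≠ ⊤ ∧ ∀ δ ∈ Ioo (0 : ℝ) 1, ∀ w, μ (shadow δ w) ≤ K * v δ := by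
  obtain ⟨C, hC, ε, hε, hbox⟩ := hbox
  set a : ℝ := min (ε / 8) (1 / 1000) with ha_def
  have ha : 0 < a := by positivity
  have ha' : a ≤ 1 / 1000 := min_le_right _ _
  have hL : ∀ δ, 0 < δ → δ < a → 1 < Real.log (1 / (8 * δ)) :=
    fun δ h0 h1 => one_lt_log_one_div h0 (h1.le.trans ha')
  set φ : ℝ → ℝ := fun δ => (Real.log (1 / (8 * δ)))⁻¹ *
      (Real.log (Real.log (1 / (8 * δ)))) ^ (-α) with hφ
  have hφm : Measurable φ := by fun_prop
  have hint : IntegrableOn (fun δ => φ δ / δ) (Ioc 0 a) := integrableOn_logWeight hα ha'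
  refine ⟨fun δ => if δ < a then ENNReal.ofReal (φ δ) else 1,
    Measurable.ite measurableSet_Iio hφm.ennreal_ofReal measurable_const, ?_, ?_,
    ENNReal.ofReal C + μ univ, by simp, ?_⟩
  · intro δ hδ
    dsimp only
    split_ifs with h
    · have h1 := hL δ hδ.1 h
      have h2 := Real.log_pos h1
      refine ⟨?_, ENNReal.ofReal_ne_top⟩
      have : 0 < φ δ := by simp only [hφ]; positivity
      simpa using this
    · simp
  · have hsub : Ioo (0 : ℝ) 1 ⊆ Ioc 0 a ∪ Ioo a 1 := by
      intro x hx
      rcases le_or_gt x a with h | h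
      · exact Or.inl ⟨hx.1, h⟩
      · exact Or.inr ⟨h, hx.2⟩
    refine ne_top_of_le_ne_top ?_ ((lintegral_mono_set hsub).trans (lintegral_union_le _ _ _))
    refine ENNReal.add_ne_top.2 ⟨?_, ?_⟩
    · rw [setLIntegral_congr Ioo_ae_eq_Ioc.symm]
      have h1 := hint.lintegral_lt_top
      rw [setLIntegral_congr Ioo_ae_eq_Ioc.symm] at h1
      refine ne_top_of_le_ne_top h1.ne (setLIntegral_mono' measurableSet_Ioo fun δ hδ => ?_)
      beta_reduce
      rw [if_pos hδ.2, ENNReal.ofReal_div_of_pos hδ.1]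
    · refine ne_top_of_le_ne_top ?_ (setLIntegral_mono' (g := fun _ => ENNReal.ofReal a⁻¹)
        measurableSet_Ioo fun δ hδ => ?_)
      · simp [ENNReal.mul_eq_top]
      · beta_reduce
        rw [if_neg (not_lt.2 hδ.1.le), ENNReal.ofReal_inv_of_pos ha, one_div]
        exact ENNReal.inv_le_inv.2 (ENNReal.ofReal_le_ofReal hδ.1.le)
  · intro δ hδ w
    dsimp only
    split_ifs with h
    · obtain ⟨θ, hθ⟩ := shadow_subset_carlesonBox hδ.1 (by linarith) w
      have hlt : 8 * δ < ε := by
        have := h.trans_le (min_le_left _ _)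
        linarith
      calc μ (shadow δ w) ≤ ENNReal.ofReal (C * φ δ) :=
            (measure_mono hθ).trans (hbox θ (8 * δ) (by linarith [hδ.1]) hlt)
        _ = ENNReal.ofReal C * ENNReal.ofReal (φ δ) := ENNReal.ofReal_mul hC.le
        _ ≤ _ := by gcongr; exact le_self_add
    · rw [mul_one]
      exact (measure_mono (subset_univ _)).trans le_add_self

theorem measurableSet_shadow :
    MeasurableSet {p : ℂ × ℝ × ℂ | p.1 ∈ shadow p.2.1 p.2.2} := by
  have hr := measurable_radialDir
  have h1 : MeasurableSet {p : ℂ × ℝ × ℂ | 1 - p.2.1 < ‖p.1‖} :=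
    measurableSet_lt (by fun_prop) (by fun_prop)
  have h2 : MeasurableSet {p : ℂ × ℝ × ℂ | ‖p.1‖ < 1} :=
    measurableSet_lt (by fun_prop) (by fun_prop)
  have h3 : MeasurableSet {p : ℂ × ℝ × ℂ |
      ‖p.2.2 - (1 - p.2.1 : ℝ) * radialDir p.1‖ < p.2.1 / 2} :=
    measurableSet_lt (by fun_prop) (by fun_prop)
  exact h1.inter (h2.inter h3)

theorem mem_Ioo_of_mem_shadow {δ : ℝ} {w z : ℂ} (hδ : δ ∈ Ioo (0 : ℝ) 1) (hz : z ∈ shadow δ w) :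
    δ ∈ Ioo (2 / 3 * (1 - ‖w‖)) (2 * (1 - ‖w‖)) := by
  obtain ⟨h1, -, h3⟩ := hz
  have hz0 : z ≠ 0 := norm_pos_iff.1 (by linarith [hδ.2])
  have hn : ‖((1 - δ : ℝ) : ℂ) * radialDir z‖ = 1 - δ := by
    rw [norm_mul, norm_radialDir hz0, mul_one, Complex.norm_real,
      Real.norm_of_nonneg (by linarith [hδ.2])]
  have h4 := (abs_norm_sub_norm_le w ((1 - δ : ℝ) * radialDir z)).trans_lt h3
  rw [hn, abs_lt] at h4
  constructor <;> linarith [h4.1, h4.2]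

theorem lintegral_inv_depth_le {d : ℝ} (hd : 0 < d) :
    ∫⁻ δ in Ioo (2 / 3 * d) (2 * d), ENNReal.ofReal (4 / (Real.pi * δ)) ≤ 3 := by
  have hpi := Real.pi_gt_three
  calc ∫⁻ δ in Ioo (2 / 3 * d) (2 * d), ENNReal.ofReal (4 / (Real.pi * δ))
      ≤ ∫⁻ _ in Ioo (2 / 3 * d) (2 * d), ENNReal.ofReal (4 / (3 * (2 / 3 * d))) := by
        refine setLIntegral_mono' measurableSet_Ioo fun δ hδ => ?_
        have := hδ.1
        gcongr
    _ ≤ 3 := by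
        rw [setLIntegral_const, Real.volume_Ioo, ← ENNReal.ofReal_mul (by positivity),
          ← ENNReal.ofReal_ofNat]
        refine ENNReal.ofReal_le_ofReal (le_of_sub_nonneg ?_)
        field_simp
        norm_num

/-- The average of the squared derivative over the tube around the radius of `z` controls the oscillation. -/
theorem enorm_sub_sq_le_lintegral_shadow {f : ℂ → ℂ} (hf : DifferentiableOn ℂ f (ball 0 1))
    {v : ℝ → ENNReal} (hv : Measurable v) (hv0 : ∀ δ ∈ Ioo (0 : ℝ) 1, v δ ≠ 0 ∧ v δ ≠ ⊤)
    {z : ℂ} (hz : z ∈ ball (0 : ℂ) 1) :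
    ‖f z - f 0‖ₑ ^ 2 ≤ (∫⁻ δ in Ioo (0 : ℝ) 1, v δ / ENNReal.ofReal δ) *
      ∫⁻ δ in Ioo (0 : ℝ) 1, ENNReal.ofReal (4 / (Real.pi * δ)) * (v δ)⁻¹ *
        ∫⁻ w in ball (0 : ℂ) 1,
          (shadow δ w).indicator (fun _ => ‖deriv f w‖ₑ ^ 2) z := by
  have hpi := Real.pi_pos
  have hm : Measurable (deriv f) := measurable_deriv f
  have hx : Measurable ({δ : ℝ | 1 - δ < ‖z‖}.indicator
      fun δ => ‖deriv f ((1 - δ : ℝ) * radialDir z)‖ₑ) := by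
    refine (hm.comp (by fun_prop)).enorm.indicator (measurableSet_lt (by fun_prop) (by fun_prop))
  refine (pow_le_pow_left₀ zero_le (enorm_sub_le_lintegral_radial hf hz) 2).trans ?_
  refine (sq_lintegral_le (volume.restrict (Ioo (0 : ℝ) 1))
    (k := fun δ => v δ / ENNReal.ofReal δ) (hv.div ENNReal.measurable_ofReal) hx ?_ ?_).trans ?_
  · refine (ae_restrict_iff' measurableSet_Ioo).2 (.of_forall fun δ hδ => ?_)
    exact (ENNReal.div_pos (hv0 δ hδ).1 ENNReal.ofReal_ne_top).ne'
  · refine (ae_restrict_iff' measurableSet_Ioo).2 (.of_forall fun δ hδ => ?_)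
    exact ENNReal.div_ne_top (hv0 δ hδ).2 (by simpa using hδ.1)
  refine mul_le_mul' le_rfl ?_
  refine setLIntegral_mono' measurableSet_Ioo fun δ hδ => ?_
  have hδ0 := hδ.1
  have hδ1 := hδ.2
  by_cases hmem : 1 - δ < ‖z‖
  swap
  · rw [indicator_of_notMem (by simpa using hmem)]
    simp
  rw [indicator_of_mem (by simpa using hmem)]
  set c : ℂ := (1 - δ : ℝ) * radialDir z with hc
  have hcn : ‖c‖ ≤ 1 - δ := by
    rw [hc, norm_mul, Complex.norm_real, Real.norm_of_nonneg (by linarith)]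
    exact mul_le_of_le_one_right (by linarith) (norm_radialDir_le z)
  have hsub : ball c (δ / 2) ⊆ ball 0 1 := ball_subset_ball' (by
    rw [dist_zero_right]; linarith)
  have hmean := enorm_sq_le_lintegral_ball (g := deriv f) (c := c) (R := δ / 2) (by positivity) hm
    ((hf.deriv isOpen_ball).mono hsub)
  have hI : ∫⁻ w in ball c (δ / 2), ‖deriv f w‖ₑ ^ 2 =
      ∫⁻ w in ball (0 : ℂ) 1, (shadow δ w).indicator (fun _ => ‖deriv f w‖ₑ ^ 2) z := by
    rw [← inter_eq_left.2 hsub, ← setLIntegral_indicator measurableSet_ball]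
    refine lintegral_congr fun w => ?_
    have hz' : ‖z‖ < 1 := by simpa using hz
    by_cases hw : w ∈ ball c (δ / 2)
    · rw [indicator_of_mem hw, indicator_of_mem]
      exact ⟨hmem, hz', by rwa [mem_ball, dist_eq_norm] at hw⟩
    · rw [indicator_of_notMem hw, indicator_of_notMem]
      exact fun h => hw (by rw [mem_ball, dist_eq_norm]; exact h.2.2)
  rw [← hI]
  obtain ⟨hv1, hv2⟩ := hv0 δ hδ
  calc ‖deriv f c‖ₑ ^ 2 / (v δ / ENNReal.ofReal δ)
      = ENNReal.ofReal (4 / (Real.pi * δ)) * (v δ)⁻¹ *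
          (ENNReal.ofReal (Real.pi * (δ / 2) ^ 2) * ‖deriv f c‖ₑ ^ 2) := by
        have e : ENNReal.ofReal δ = ENNReal.ofReal (4 / (Real.pi * δ)) *
            ENNReal.ofReal (Real.pi * (δ / 2) ^ 2) := by
          rw [← ENNReal.ofReal_mul (by positivity)]
          congr 1
          field_simp
          norm_num
        rw [div_eq_mul_inv, ENNReal.inv_div (by simp) (Or.inr hv1), div_eq_mul_inv, e]
        ring
    _ ≤ _ := by gcongr

/-- Carleson embedding for the seminorm, with the box condition replaced by a shadow bound. -/
theorem lintegral_enorm_sub_sq_le {f : ℂ → ℂ} (hf : DifferentiableOn ℂ f (ball 0 1))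
    (μ : Measure ℂ) [IsFiniteMeasure μ]
    {v : ℝ → ENNReal} (hv : Measurable v) (hv0 : ∀ δ ∈ Ioo (0 : ℝ) 1, v δ ≠ 0 ∧ v δ ≠ ⊤)
    {K : ENNReal} (hK : ∀ δ ∈ Ioo (0 : ℝ) 1, ∀ w, μ (shadow δ w) ≤ K * v δ) :
    ∫⁻ z in ball (0 : ℂ) 1, ‖f z - f 0‖ₑ ^ 2 ∂μ ≤
      (∫⁻ δ in Ioo (0 : ℝ) 1, v δ / ENNReal.ofReal δ) * (3 * K) *
        ∫⁻ w in ball (0 : ℂ) 1, ‖deriv f w‖ₑ ^ 2 := by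
  have hm : Measurable (deriv f) := measurable_deriv f
  have hS := measurableSet_shadow
  have hH : Measurable fun p : ℂ × ℝ × ℂ =>
      (shadow p.2.1 p.2.2).indicator (fun _ => ‖deriv f p.2.2‖ₑ ^ 2) p.1 := by
    have h1 : Measurable fun p : ℂ × ℝ × ℂ => ‖deriv f p.2.2‖ₑ ^ 2 := by fun_prop
    exact h1.indicator hS
  have hc : Measurable fun δ : ℝ => ENNReal.ofReal (4 / (Real.pi * δ)) * (v δ)⁻¹ := by fun_prop
  have hinner : Measurable fun p : ℂ × ℝ => ∫⁻ w in ball (0 : ℂ) 1,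
      (shadow p.2 w).indicator (fun _ => ‖deriv f w‖ₑ ^ 2) p.1 := by
    refine Measurable.lintegral_prod_right' (f := fun q : (ℂ × ℝ) × ℂ =>
      (shadow q.1.2 q.2).indicator (fun _ => ‖deriv f q.2‖ₑ ^ 2) q.1.1) ?_
    exact hH.comp (measurable_fst.fst.prodMk (measurable_fst.snd.prodMk measurable_snd))
  calc ∫⁻ z in ball (0 : ℂ) 1, ‖f z - f 0‖ₑ ^ 2 ∂μ
      ≤ ∫⁻ z in ball (0 : ℂ) 1, (∫⁻ δ in Ioo (0 : ℝ) 1, v δ / ENNReal.ofReal δ) *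
          (∫⁻ δ in Ioo (0 : ℝ) 1, ENNReal.ofReal (4 / (Real.pi * δ)) * (v δ)⁻¹ *
            ∫⁻ w in ball (0 : ℂ) 1,
              (shadow δ w).indicator (fun _ => ‖deriv f w‖ₑ ^ 2) z) ∂μ :=
        setLIntegral_mono' measurableSet_ball fun z hz =>
          enorm_sub_sq_le_lintegral_shadow hf hv hv0 hz
    _ ≤ ∫⁻ z, (∫⁻ δ in Ioo (0 : ℝ) 1, v δ / ENNReal.ofReal δ) *
          (∫⁻ δ in Ioo (0 : ℝ) 1, ENNReal.ofReal (4 / (Real.pi * δ)) * (v δ)⁻¹ *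
            ∫⁻ w in ball (0 : ℂ) 1,
              (shadow δ w).indicator (fun _ => ‖deriv f w‖ₑ ^ 2) z) ∂μ :=
        setLIntegral_le_lintegral _ _
    _ = (∫⁻ δ in Ioo (0 : ℝ) 1, v δ / ENNReal.ofReal δ) *
          ∫⁻ δ in Ioo (0 : ℝ) 1, ENNReal.ofReal (4 / (Real.pi * δ)) * (v δ)⁻¹ *
            ∫⁻ w in ball (0 : ℂ) 1, ‖deriv f w‖ₑ ^ 2 * μ (shadow δ w) := by
        have hm1 : Measurable fun p : ℂ × ℝ => ENNReal.ofReal (4 / (Real.pi * p.2)) * (v p.2)⁻¹ *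
            ∫⁻ w in ball (0 : ℂ) 1,
              (shadow p.2 w).indicator (fun _ => ‖deriv f w‖ₑ ^ 2) p.1 :=
          (hc.comp measurable_snd).mul hinner
        rw [lintegral_const_mul _ hm1.lintegral_prod_right', lintegral_lintegral_swap
          hm1.aemeasurable]
        congr 1
        refine lintegral_congr fun δ => ?_
        have hδm := hinner.comp (measurable_prodMk_right (y := δ))
        simp only [Function.comp_def] at hδm
        dsimp only
        have hδH : Measurable (Function.uncurry fun z w =>
            (shadow δ w).indicator (fun _ => ‖deriv f w‖ₑ ^ 2) z) :=
          hH.comp (measurable_fst.prodMk (measurable_const.prodMk measurable_snd))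
        rw [lintegral_const_mul _ hδm, lintegral_lintegral_swap hδH.aemeasurable]
        congr 1
        refine lintegral_congr fun w => ?_
        have hsh : MeasurableSet (shadow δ w) := hS.preimage (measurable_prodMk_right (y := (δ, w)))
        rw [lintegral_indicator_const hsh]
    _ ≤ (∫⁻ δ in Ioo (0 : ℝ) 1, v δ / ENNReal.ofReal δ) *
          ∫⁻ δ in Ioo (0 : ℝ) 1, ∫⁻ w in ball (0 : ℂ) 1, K * ‖deriv f w‖ₑ ^ 2 *
            {p : ℝ × ℂ | p.1 ∈ Ioo (2 / 3 * (1 - ‖p.2‖)) (2 * (1 - ‖p.2‖))}.indicator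
              (fun p => ENNReal.ofReal (4 / (Real.pi * p.1))) (δ, w) := by
        refine mul_le_mul' le_rfl ?_
        refine setLIntegral_mono' measurableSet_Ioo fun δ hδ => ?_
        obtain ⟨hv1, hv2⟩ := hv0 δ hδ
        rw [← lintegral_const_mul' _ _ (by finiteness)]
        refine lintegral_mono fun w => ?_
        rcases (shadow δ w).eq_empty_or_nonempty with h | ⟨y, hy⟩
        · simp [h]
        · rw [indicator_of_mem (by exact mem_Ioo_of_mem_shadow hδ hy)]
          calc ENNReal.ofReal (4 / (Real.pi * δ)) * (v δ)⁻¹ *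
                (‖deriv f w‖ₑ ^ 2 * μ (shadow δ w))
              ≤ ENNReal.ofReal (4 / (Real.pi * δ)) * (v δ)⁻¹ *
                (‖deriv f w‖ₑ ^ 2 * (K * v δ)) := by gcongr; exact hK δ hδ w
            _ = K * ‖deriv f w‖ₑ ^ 2 * ENNReal.ofReal (4 / (Real.pi * δ)) *
                (v δ * (v δ)⁻¹) := by ring
            _ = _ := by rw [ENNReal.mul_inv_cancel hv1 hv2, mul_one]
    _ ≤ (∫⁻ δ in Ioo (0 : ℝ) 1, v δ / ENNReal.ofReal δ) *
          ∫⁻ w in ball (0 : ℂ) 1, K * ‖deriv f w‖ₑ ^ 2 * 3 := by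
        refine mul_le_mul' le_rfl ?_
        have hE : MeasurableSet {p : ℝ × ℂ |
            p.1 ∈ Ioo (2 / 3 * (1 - ‖p.2‖)) (2 * (1 - ‖p.2‖))} := by
          have h1 : MeasurableSet {p : ℝ × ℂ | 2 / 3 * (1 - ‖p.2‖) < p.1} :=
            measurableSet_lt (by fun_prop) (by fun_prop)
          have h2 : MeasurableSet {p : ℝ × ℂ | p.1 < 2 * (1 - ‖p.2‖)} :=
            measurableSet_lt (by fun_prop) (by fun_prop)
          exact h1.inter h2
        have hEm := Measurable.indicator (f := fun p : ℝ × ℂ =>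
          ENNReal.ofReal (4 / (Real.pi * p.1))) (by fun_prop) hE
        rw [lintegral_lintegral_swap (Measurable.aemeasurable
          (((hm.comp measurable_snd).enorm.pow_const 2).const_mul K |>.mul hEm))]
        refine setLIntegral_mono' measurableSet_ball fun w hw => ?_
        have hwm := hEm.comp (measurable_prodMk_right (y := w))
        simp only [Function.comp_def] at hwm
        rw [lintegral_const_mul _ hwm]
        gcongr
        refine (setLIntegral_le_lintegral _ _).trans ?_
        have hw' : 0 < 1 - ‖w‖ := by simpa using hw
        refine le_trans (le_of_eq ?_) (lintegral_inv_depth_le hw')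
        rw [← lintegral_indicator measurableSet_Ioo]
        rfl
    _ = _ := by
        rw [lintegral_mul_const _ (by fun_prop), lintegral_const_mul _ (by fun_prop)]
        ring

/-- If `μ` is a finite Borel measure on the unit disk with
`μ(S(I)) = O((log(1/|I|))⁻¹ (log log(1/|I|))^{-α})` as `|I| → 0` for some `α > 1`,
then `μ` is a Carleson measure for the Dirichlet space. -/
theorem statement2 (α : ℝ) (hα : 1 < α) (μ : Measure ℂ) [IsFiniteMeasure μ]
    (hμsupp : μ (Metric.ball (0:ℂ) 1)ᶜ = 0)
    (hbox : ∃ C > (0:ℝ), ∃ ε > (0:ℝ), ∀ θ ℓ : ℝ, 0 < ℓ → ℓ < ε →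
      μ (carlesonBox θ ℓ) ≤ ENNReal.ofReal
        (C * ((Real.log (1/ℓ))⁻¹ * (Real.log (Real.log (1/ℓ))) ^ (-α)))) :
    IsCarlesonDirichlet μ := by
  obtain ⟨v, hv, hv0, hJ, K, hK, hbound⟩ := exists_weight hα μ hbox
  set M : ENNReal := (∫⁻ δ in Ioo (0 : ℝ) 1, v δ / ENNReal.ofReal δ) * (3 * K) with hM
  have hM' : M ≠ ⊤ := by finiteness
  have hpi := Real.pi_pos
  refine ⟨2 * (μ univ).toReal + 2 * (Real.pi * M.toReal), fun f hf => ?_⟩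
  obtain ⟨hfd, hfi⟩ := hf
  set D : ℝ := ∫ z in ball (0 : ℂ) 1, ‖deriv f z‖ ^ 2 with hD
  have hD0 : 0 ≤ D := integral_nonneg fun _ => by positivity
  have hDl : ∫⁻ w in ball (0 : ℂ) 1, ‖deriv f w‖ₑ ^ 2 = ENNReal.ofReal D := by
    rw [hD, ofReal_integral_eq_lintegral_ofReal hfi (.of_forall fun _ => by positivity)]
    simp_rw [ENNReal.ofReal_pow (norm_nonneg _), ofReal_norm]
  have hmain := lintegral_enorm_sub_sq_le hfd μ hv hv0 hbound
  rw [← hM, hDl] at hmain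
  have hpt : ∀ z, ENNReal.ofReal (‖f z‖ ^ 2) ≤
      ENNReal.ofReal (2 * ‖f 0‖ ^ 2) + 2 * ‖f z - f 0‖ₑ ^ 2 := by
    intro z
    have h1 : ‖f z‖ ≤ ‖f 0‖ + ‖f z - f 0‖ := norm_le_insert' _ _
    rw [← ofReal_norm, ← ENNReal.ofReal_pow (norm_nonneg _), ← ENNReal.ofReal_ofNat,
      ← ENNReal.ofReal_mul (by norm_num), ← ENNReal.ofReal_add (by positivity) (by positivity)]
    refine ENNReal.ofReal_le_ofReal ?_
    nlinarith [sq_nonneg (‖f 0‖ - ‖f z - f 0‖), norm_nonneg (f z)]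
  calc ∫⁻ z in ball (0:ℂ) 1, ENNReal.ofReal (‖f z‖ ^ 2) ∂μ
      ≤ ∫⁻ z in ball (0:ℂ) 1, (ENNReal.ofReal (2 * ‖f 0‖ ^ 2) + 2 * ‖f z - f 0‖ₑ ^ 2) ∂μ :=
        lintegral_mono hpt
    _ = ENNReal.ofReal (2 * ‖f 0‖ ^ 2) * μ (ball 0 1) +
          2 * ∫⁻ z in ball (0:ℂ) 1, ‖f z - f 0‖ₑ ^ 2 ∂μ := by
        rw [lintegral_add_left measurable_const, setLIntegral_const,
          lintegral_const_mul' _ _ (by simp)]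
    _ ≤ ENNReal.ofReal (2 * ‖f 0‖ ^ 2) * ENNReal.ofReal (μ univ).toReal +
          2 * (ENNReal.ofReal M.toReal * ENNReal.ofReal D) := by
        rw [ENNReal.ofReal_toReal (measure_ne_top _ _), ENNReal.ofReal_toReal hM']
        gcongr
        exact subset_univ _
    _ = ENNReal.ofReal (2 * ‖f 0‖ ^ 2 * (μ univ).toReal + 2 * (M.toReal * D)) := by
        rw [ENNReal.ofReal_add (by positivity) (by positivity),
          ENNReal.ofReal_mul (p := 2 * ‖f 0‖ ^ 2) (by positivity),
          ENNReal.ofReal_mul (p := 2) (q := M.toReal * D) (by norm_num),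
          ENNReal.ofReal_mul (p := M.toReal) (by positivity), ENNReal.ofReal_ofNat]
    _ ≤ _ := by
        refine ENNReal.ofReal_le_ofReal ?_
        rw [dirichletNormSq, ← hD]
        have h1 : 0 ≤ 2 * (μ univ).toReal * (1 / Real.pi * D) := by positivity
        have h2 : 0 ≤ Real.pi * M.toReal * ‖f 0‖ ^ 2 := by positivity
        have h3 : 2 * (Real.pi * M.toReal) * (1 / Real.pi * D) = 2 * (M.toReal * D) := by
          field_simp
        linarith [mul_add (2 * (μ univ).toReal + 2 * (Real.pi * M.toReal)) (‖f 0‖ ^ 2)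
          (1 / Real.pi * D), add_mul (2 * (μ univ).toReal) (2 * (Real.pi * M.toReal))
          (‖f 0‖ ^ 2), add_mul (2 * (μ univ).toReal) (2 * (Real.pi * M.toReal))
          (1 / Real.pi * D)]

end
end
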